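/- arXiv:2412.20900 — 2 statements merged into one kernel-verified Lean document; each statement's English description precedes it below -/
import Mathlib

section
/- Let X be a real Banach space and let 1 ≤ p ≤ 2 ≤ q < ∞. Suppose there exist measure spaces (Ω₁, μ₁) and (Ω₂, μ₂) and bi-Lipschitz embeddings f : X → L^q(μ₁; ℝ) and g : X → L^p(μ₂; ℝ). Then X is isomorphic to a Hilbert space. -/
open MeasureTheory
open scoped ENNReal

universe u v w

variable (X : Type u) [NormedAddCommGroup X] [NormedSpace ℝ X]

/-- `f` is a real inner product on `X`: symmetric, bilinear, positive definite. -/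
def IsRealInner (f : X → X → ℝ) : Prop :=
  (∀ x y, f x y = f y x) ∧
  (∀ (a : ℝ) (x y : X), f (a • x) y = a * f x y) ∧
  (∀ x y z : X, f (x + y) z = f x z + f y z) ∧
  (∀ x : X, x ≠ 0 → 0 < f x x)

/-- `X` is isomorphic to a Hilbert space: there is a real inner product on `X` whose
induced norm is equivalent to the given norm. -/
def IsomorphicToHilbert : Prop :=
  ∃ f : X → X → ℝ, IsRealInner X f ∧
    ∃ a b : ℝ, 0 < a ∧ 0 < b ∧ ∀ x : X, a * ‖x‖ ^ 2 ≤ f x x ∧ f x x ≤ b * ‖x‖ ^ 2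

open Finset

section Averaging

variable {G : Type*} [AddCommGroup G]

/-- Finite Følner families in abelian groups, expressed through averages of bounded functions. -/
lemma exists_almost_invariant_family (F : Type*) [NormedAddCommGroup F]
    (S : Finset G) {δ : ℝ} (hδ : 0 < δ) :
    ∃ (ι : Type) (_ : Fintype ι) (_ : Nonempty ι) (a : ι → G), ∀ s ∈ S, ∀ (h : G → F) (C : ℝ),
      (∀ x, ‖h x‖ ≤ C) → ‖∑ i, (h (a i + s) - h (a i))‖ ≤ δ * C * Fintype.card ι := by
  classical
  induction S using Finset.induction_on with
  | empty => exact ⟨Unit, inferInstance, inferInstance, fun _ => 0, by simp⟩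
  | insert s S _ ih =>
    obtain ⟨ι, _, _, a, ha⟩ := ih
    obtain ⟨m, hm⟩ := exists_nat_gt (2 / δ)
    have hm0 : 0 < m := by
      have : (0 : ℝ) < m := lt_of_le_of_lt (by positivity) hm
      exact_mod_cast this
    have : Nonempty (Fin m) := ⟨⟨0, hm0⟩⟩
    refine ⟨ι × Fin m, inferInstance, inferInstance, fun x => a x.1 + (x.2 : ℕ) • s, ?_⟩
    intro t ht h C hC
    have hC0 : 0 ≤ C := (norm_nonneg _).trans (hC 0)
    rw [Fintype.card_prod, Fintype.card_fin, Nat.cast_mul]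
    rcases Finset.mem_insert.1 ht with rfl | ht
    · rw [Fintype.sum_prod_type]
      have key : ∀ i, ∑ k : Fin m, (h (a i + (k : ℕ) • t + t) - h (a i + (k : ℕ) • t))
          = h (a i + m • t) - h (a i) := by
        intro i
        rw [Fin.sum_univ_eq_sum_range
          (fun k => h (a i + k • t + t) - h (a i + k • t)) m]
        have := Finset.sum_range_sub (fun k => h (a i + k • t)) m
        simpa [succ_nsmul, add_assoc] using this
      simp only [key]
      calc ‖∑ i, (h (a i + m • t) - h (a i))‖ ≤ ∑ _i : ι, (C + C) :=
            norm_sum_le_of_le _ fun i _ => (norm_sub_le _ _).trans (add_le_add (hC _) (hC _))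
        _ = Fintype.card ι * (2 * C) := by simp; ring
        _ ≤ δ * C * (Fintype.card ι * m) := by
            have : 2 ≤ δ * m := by
              rw [div_lt_iff₀ hδ] at hm; linarith
            have h2 : 0 ≤ (Fintype.card ι : ℝ) * C := by positivity
            nlinarith
    · rw [Fintype.sum_prod_type_right]
      calc ‖∑ k : Fin m, ∑ i, (h (a i + (k : ℕ) • s + t) - h (a i + (k : ℕ) • s))‖
          ≤ ∑ _k : Fin m, δ * C * Fintype.card ι := by
            refine norm_sum_le_of_le _ fun k _ => ?_
            have := ha t ht (fun x => h (x + (k : ℕ) • s)) C (fun x => hC _)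
            simpa [add_right_comm] using this
        _ = δ * C * (Fintype.card ι * m) := by simp; ring

end Averaging

section Linearization

variable {X : Type*} [NormedAddCommGroup X]
  {Y : Type*} [NormedAddCommGroup Y] [NormedSpace ℝ Y]

/-- The average over `a` of the increments of `f` in direction `x` based at `z`. -/
noncomputable def averagedIncrement {ι : Type} [Fintype ι] (f : X → Y) (a : ι → X) (z x : X) : Y :=
  (Fintype.card ι : ℝ)⁻¹ • ∑ i, (f (z + a i + x) - f (z + a i))

variable {ι : Type} [Fintype ι] [Nonempty ι] {f : X → Y} {a : ι → X} {L c : ℝ}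

lemma norm_averagedIncrement_le (hL : ∀ x y, ‖f x - f y‖ ≤ L * ‖x - y‖) (z x : X) :
    ‖averagedIncrement f a z x‖ ≤ L * ‖x‖ := by
  rw [averagedIncrement, norm_smul, norm_inv, Real.norm_natCast, inv_mul_le_iff₀ (by positivity)]
  refine (norm_sum_le_of_le (n := fun _ => L * ‖x‖) _ fun i _ => ?_).trans (by simp)
  simpa using hL (z + a i + x) (z + a i)

lemma norm_averagedIncrement_add_sub_le {S : Finset X} {δ : ℝ}
    (ha : ∀ s ∈ S, ∀ (h : X → Y) (C : ℝ), (∀ x, ‖h x‖ ≤ C) →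
      ‖∑ i, (h (a i + s) - h (a i))‖ ≤ δ * C * Fintype.card ι)
    (hL : ∀ x y, ‖f x - f y‖ ≤ L * ‖x - y‖) (z x : X) {x' : X} (hx' : x' ∈ S) :
    ‖averagedIncrement f a z (x + x') - averagedIncrement f a z x - averagedIncrement f a z x'‖
      ≤ δ * (L * ‖x‖) := by
  have h1 := ha x' hx' (fun w => f (z + w + x) - f (z + w)) (L * ‖x‖) fun w => by
    simpa using hL (z + w + x) (z + w)
  have h2 : averagedIncrement f a z (x + x') - averagedIncrement f a z x
      - averagedIncrement f a z x' = (Fintype.card ι : ℝ)⁻¹ •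
        ∑ i, ((f (z + (a i + x') + x) - f (z + (a i + x'))) - (f (z + a i + x) - f (z + a i))) := by
    simp only [averagedIncrement, ← smul_sub, ← Finset.sum_sub_distrib]
    congr 1
    refine Finset.sum_congr rfl fun i _ => ?_
    rw [show z + a i + (x + x') = z + (a i + x') + x by abel,
      show z + a i + x' = z + (a i + x') by abel]
    abel
  rw [h2, norm_smul, norm_inv, Real.norm_natCast, inv_mul_le_iff₀ (by positivity)]
  linarith

variable [NormedSpace ℝ X]

lemma le_sum_norm_averagedIncrement (hL : ∀ x y, ‖f x - f y‖ ≤ L * ‖x - y‖)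
    (hc : ∀ x y, c * ‖x - y‖ ≤ ‖f x - f y‖) {B : ℝ} (hB : ∀ i, L * ‖a i‖ ≤ B) (z x : X) (K : ℕ) :
    K * (c * ‖x‖) - 2 * B ≤ ∑ k ∈ range K, ‖averagedIncrement f a (z + k • x) x‖ := by
  have hcard : (0 : ℝ) < Fintype.card ι := by positivity
  have h1 : ∑ k ∈ range K, averagedIncrement f a (z + k • x) x
      = (Fintype.card ι : ℝ)⁻¹ • ∑ i, (f (z + a i + K • x) - f (z + a i)) := by
    simp only [averagedIncrement, ← Finset.smul_sum]
    rw [Finset.sum_comm]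
    congr 1
    refine Finset.sum_congr rfl fun i _ => ?_
    have := Finset.sum_range_sub (fun k => f (z + a i + k • x)) K
    rw [zero_smul, add_zero] at this
    rw [← this]
    refine Finset.sum_congr rfl fun k _ => ?_
    rw [succ_nsmul]
    congr 2 <;> abel
  have h2 : f (z + K • x) - f z = (Fintype.card ι : ℝ)⁻¹ • ∑ i, (f (z + a i + K • x) - f (z + a i))
      - (Fintype.card ι : ℝ)⁻¹ • ∑ i, ((f (z + a i + K • x) - f (z + K • x))
        - (f (z + a i) - f z)) := by
    rw [← smul_sub, ← Finset.sum_sub_distrib, eq_inv_smul_iff₀ hcard.ne']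
    rw [Finset.sum_congr rfl (g := fun _ => f (z + K • x) - f z) (fun i _ => by abel)]
    simp [← Nat.cast_smul_eq_nsmul ℝ, smul_sub]
  have h3 : ‖(Fintype.card ι : ℝ)⁻¹ • ∑ i, ((f (z + a i + K • x) - f (z + K • x))
        - (f (z + a i) - f z))‖ ≤ 2 * B := by
    rw [norm_smul, norm_inv, Real.norm_natCast, inv_mul_le_iff₀ hcard]
    refine (norm_sum_le_of_le (n := fun _ => 2 * B) _ fun i _ => ?_).trans (by simp)
    have e1 := hL (z + a i + K • x) (z + K • x)
    have e2 := hL (z + a i) z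
    rw [show z + a i + K • x - (z + K • x) = a i by abel] at e1
    rw [show z + a i - z = a i by abel] at e2
    have := norm_sub_le (f (z + a i + K • x) - f (z + K • x)) (f (z + a i) - f z)
    linarith [hB i]
  have h4 : K * (c * ‖x‖) ≤ ‖f (z + K • x) - f z‖ := by
    have := hc (z + K • x) z
    rw [add_sub_cancel_left, ← Nat.cast_smul_eq_nsmul ℝ, norm_smul, Real.norm_natCast] at this
    rw [← Nat.cast_smul_eq_nsmul ℝ]
    linarith
  have h5 := norm_sum_le (range K) fun k => averagedIncrement f a (z + k • x) x
  rw [h1] at h5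
  rw [h2] at h4
  have h6 := norm_sub_le ((Fintype.card ι : ℝ)⁻¹ • ∑ i, (f (z + a i + K • x) - f (z + a i)))
    ((Fintype.card ι : ℝ)⁻¹ • ∑ i, ((f (z + a i + K • x) - f (z + K • x)) - (f (z + a i) - f z)))
  linarith

/-- A bi-Lipschitz map can be replaced, on a finite set, by a finite family of almost additive maps
which are bounded below in quadratic mean. -/
lemma exists_almost_additive_family (hL0 : 0 < L) (hL : ∀ x y, ‖f x - f y‖ ≤ L * ‖x - y‖)
    (hc0 : 0 ≤ c) (hc : ∀ x y, c * ‖x - y‖ ≤ ‖f x - f y‖) (S : Finset X) {δ : ℝ} (hδ : 0 < δ) :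
    ∃ (κ : Type) (_ : Fintype κ) (_ : Nonempty κ) (D : κ → X → Y),
      (∀ k x, ‖D k x‖ ≤ L * ‖x‖) ∧
      (∀ k, ∀ x ∈ S, ∀ x' ∈ S, ‖D k (x + x') - D k x - D k x'‖ ≤ δ) ∧
      ∀ x ∈ S, Fintype.card κ * (c ^ 2 * ‖x‖ ^ 2) ≤
        2 * ∑ k, ‖D k x‖ ^ 2 + Fintype.card κ * (2 * δ ^ 2) := by
  classical
  obtain ⟨R, hR0, hR⟩ : ∃ R : ℝ, 0 < R ∧ ∀ x ∈ S, ‖x‖ ≤ R := by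
    obtain ⟨R, hR⟩ := (S.image norm).bddAbove
    refine ⟨max R 1, by positivity, fun x hx => le_max_of_le_left (hR ?_)⟩
    simpa using ⟨x, hx, rfl⟩
  obtain ⟨ι, _, _, a, ha⟩ := exists_almost_invariant_family Y S
    (δ := δ / (L * R)) (by positivity)
  obtain ⟨B, hB⟩ : ∃ B : ℝ, ∀ i, L * ‖a i‖ ≤ B := by
    obtain ⟨B, hB⟩ := (Set.finite_range fun i => L * ‖a i‖).bddAbove
    exact ⟨B, fun i => hB ⟨i, rfl⟩⟩
  obtain ⟨K, hK⟩ := exists_nat_gt (max 1 (4 * B / δ))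
  have hK1 : (1 : ℝ) < K := (le_max_left _ _).trans_lt hK
  have hK2 : 4 * B < δ * K := by
    have := (le_max_right _ _).trans_lt hK
    rw [div_lt_iff₀ hδ] at this
    linarith
  obtain ⟨κ, _, _, b, hb⟩ := exists_almost_invariant_family ℝ
    ((S ×ˢ range K).image fun p => p.2 • p.1) (δ := δ / (2 * (L * R))) (by positivity)
  refine ⟨κ, inferInstance, inferInstance, fun k => averagedIncrement f a (b k),
    fun k x => norm_averagedIncrement_le hL _ _, fun k x hx x' hx' => ?_, fun x hx => ?_⟩
  · refine (norm_averagedIncrement_add_sub_le ha hL _ _ hx').trans ?_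
    calc δ / (L * R) * (L * ‖x‖) ≤ δ / (L * R) * (L * R) := by
          gcongr; exact hR x hx
      _ = δ := by field_simp
  · have hκ : (0 : ℝ) < Fintype.card κ := by positivity
    set N : X → ℝ := fun z => ‖averagedIncrement f a z x‖ with hN
    have hN_le : ∀ z, ‖N z‖ ≤ L * R := fun z => by
      rw [hN, norm_norm]
      exact (norm_averagedIncrement_le hL _ _).trans (by gcongr; exact hR x hx)
    have h1 : ∀ k ∈ range K, ∑ j, N (b j + k • x) ≤ ∑ j, N (b j) + δ / 2 * Fintype.card κ := by
      intro k hk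
      have := hb (k • x) (Finset.mem_image.2 ⟨(x, k), by simp [hx, Finset.mem_range.1 hk], rfl⟩)
        N (L * R) hN_le
      rw [Finset.sum_sub_distrib] at this
      have e : δ / (2 * (L * R)) * (L * R) = δ / 2 := by field_simp
      rw [e] at this
      linarith [(abs_le.1 this).2]
    have h2 : ∑ j, (K * (c * ‖x‖) - 2 * B) ≤ ∑ j, ∑ k ∈ range K, N (b j + k • x) :=
      Finset.sum_le_sum fun j _ => le_sum_norm_averagedIncrement hL hc hB _ _ _
    rw [Finset.sum_comm] at h2
    have h3 := h2.trans (Finset.sum_le_sum h1)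
    simp only [Finset.sum_const, Finset.card_univ, nsmul_eq_mul, Finset.card_range] at h3
    have h4 : Fintype.card κ * (c * ‖x‖) ≤ ∑ j, N (b j) + Fintype.card κ * δ := by
      have : (K : ℝ) * (Fintype.card κ * (c * ‖x‖)) ≤ K * (∑ j, N (b j) + Fintype.card κ * δ) := by
        nlinarith
      exact le_of_mul_le_mul_left this (by linarith)
    have h5 : (∑ j, N (b j)) ^ 2 ≤ Fintype.card κ * ∑ j, N (b j) ^ 2 := sq_sum_le_card_mul_sum_sq
    have h6 : (Fintype.card κ * (c * ‖x‖)) ^ 2 ≤ (∑ j, N (b j) + Fintype.card κ * δ) ^ 2 :=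
      pow_le_pow_left₀ (by positivity) h4 2
    have h7 : Fintype.card κ * (Fintype.card κ * (c ^ 2 * ‖x‖ ^ 2)) ≤
        Fintype.card κ * (2 * ∑ j, N (b j) ^ 2 + Fintype.card κ * (2 * δ ^ 2)) := by
      nlinarith [sq_nonneg (∑ j, N (b j) - Fintype.card κ * δ)]
    exact le_of_mul_le_mul_left h7 hκ

end Linearization

section Rademacher

/-- Rademacher type 2 with (squared) constant `C`. -/
def HasTypeTwo (E : Type*) [NormedAddCommGroup E] (C : ℝ) : Prop :=
  ∀ (n : ℕ) (v : Fin n → E),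
    ∑ ε : Fin n → ℤˣ, ‖∑ j, ε j • v j‖ ^ 2 ≤ C * (2 ^ n * ∑ j, ‖v j‖ ^ 2)

/-- Rademacher cotype 2 with (squared) constant `C`. -/
def HasCotypeTwo (E : Type*) [NormedAddCommGroup E] (C : ℝ) : Prop :=
  ∀ (n : ℕ) (v : Fin n → E),
    2 ^ n * ∑ j, ‖v j‖ ^ 2 ≤ C * ∑ ε : Fin n → ℤˣ, ‖∑ j, ε j • v j‖ ^ 2

lemma sum_signs_succ {E M : Type*} [AddCommGroup E] [AddCommMonoid M] {n : ℕ}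
    (v : Fin (n + 1) → E) (F : E → M) :
    ∑ ε : Fin (n + 1) → ℤˣ, F (∑ j, ε j • v j) =
      ∑ ε : Fin n → ℤˣ, (F (∑ j, ε j • v j.succ + v 0) + F (∑ j, ε j • v j.succ - v 0)) := by
  rw [← (Fin.consEquiv fun _ => ℤˣ).sum_comp, Fintype.sum_prod_type_right]
  refine Finset.sum_congr rfl fun ε _ => ?_
  rw [show (univ : Finset ℤˣ) = {1, -1} from rfl, Finset.sum_pair (by decide)]
  simp [Fin.consEquiv, Fin.sum_univ_succ, add_comm, sub_eq_add_neg]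

lemma norm_sum_signs_sub_le {X Y : Type*} [AddCommGroup X] [NormedAddCommGroup Y]
    {n : ℕ} (v : Fin n → X) {S : Finset X}
    (hS : ∀ (J : Finset (Fin n)) (ε : Fin n → ℤˣ), ∑ j ∈ J, ε j • v j ∈ S) {D : X → Y}
    (hD0 : D 0 = 0) {δ : ℝ}
    (hD : ∀ x ∈ S, ∀ x' ∈ S, ‖D (x + x') - D x - D x'‖ ≤ δ) (ε : Fin n → ℤˣ)
    (J : Finset (Fin n)) :
    ‖D (∑ j ∈ J, ε j • v j) - ∑ j ∈ J, ε j • D (v j)‖ ≤ #J * (2 * δ) := by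
  have hS1 : ∀ (j : Fin n) (u : ℤˣ), u • v j ∈ S := fun j u => by
    simpa using hS {j} fun _ => u
  have hneg : ∀ (j : Fin n) (u : ℤˣ), ‖D (u • v j) - u • D (v j)‖ ≤ δ := by
    intro j u
    have h := hD (v j) (by simpa using hS1 j 1) (-v j) (by simpa using hS1 j (-1))
    rcases Int.units_eq_one_or u with rfl | rfl
    · simpa using (norm_nonneg _).trans h
    · rw [add_neg_cancel, hD0, zero_sub, ← norm_neg] at h
      simpa [add_comm] using h
  induction J using Finset.induction_on with
  | empty => simp [hD0]
  | insert j J hj ih =>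
    rw [Finset.sum_insert hj, Finset.sum_insert hj, Finset.card_insert_of_notMem hj]
    have h1 := hD (ε j • v j) (hS1 j _) _ (hS J ε)
    have h2 := hneg j (ε j)
    have e : D (ε j • v j + ∑ j ∈ J, ε j • v j) - (ε j • D (v j) + ∑ j ∈ J, ε j • D (v j))
        = (D (ε j • v j + ∑ j ∈ J, ε j • v j) - D (ε j • v j) - D (∑ j ∈ J, ε j • v j))
          + (D (ε j • v j) - ε j • D (v j))
          + (D (∑ j ∈ J, ε j • v j) - ∑ j ∈ J, ε j • D (v j)) := by abel
    rw [e]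
    refine norm_add₃_le.trans ?_
    push_cast
    linarith

lemma sq_norm_le_of_norm_sub_le {E : Type*} [NormedAddCommGroup E] {x y : E} {η : ℝ}
    (h : ‖x - y‖ ≤ η) : ‖x‖ ^ 2 ≤ 2 * ‖y‖ ^ 2 + 2 * η ^ 2 := by
  have h1 : ‖x‖ ≤ ‖y‖ + η := by linarith [norm_sub_norm_le x y]
  have h2 : ‖x‖ ^ 2 ≤ (‖y‖ + η) ^ 2 := pow_le_pow_left₀ (norm_nonneg _) h1 2
  nlinarith [sq_nonneg (‖y‖ - η)]

variable {X : Type*} [NormedAddCommGroup X] [NormedSpace ℝ X]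
  {Y : Type*} [NormedAddCommGroup Y] [NormedSpace ℝ Y] {f : X → Y} {L c C : ℝ}

/-- The almost additive families of `exists_almost_additive_family`, on sign combinations. -/
lemma exists_almost_linear_on_signs
    (hL0 : 0 < L) (hL : ∀ x y, ‖f x - f y‖ ≤ L * ‖x - y‖) (hc0 : 0 ≤ c)
    (hc : ∀ x y, c * ‖x - y‖ ≤ ‖f x - f y‖) {n : ℕ} (v : Fin n → X) {δ : ℝ} (hδ : 0 < δ) :
    ∃ (κ : Type) (_ : Fintype κ) (_ : Nonempty κ) (D : κ → X → Y),
      (∀ k x, ‖D k x‖ ≤ L * ‖x‖) ∧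
      (∀ k (ε : Fin n → ℤˣ), ‖D k (∑ j, ε j • v j) - ∑ j, ε j • D k (v j)‖ ≤ n * (2 * δ)) ∧
      (∀ ε : Fin n → ℤˣ, Fintype.card κ * (c ^ 2 * ‖∑ j, ε j • v j‖ ^ 2) ≤
        2 * ∑ k, ‖D k (∑ j, ε j • v j)‖ ^ 2 + Fintype.card κ * (2 * δ ^ 2)) ∧
      ∀ j, Fintype.card κ * (c ^ 2 * ‖v j‖ ^ 2) ≤
        2 * ∑ k, ‖D k (v j)‖ ^ 2 + Fintype.card κ * (2 * δ ^ 2) := by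
  classical
  set S : Finset X := univ.image
    fun p : Finset (Fin n) × (Fin n → ℤˣ) => ∑ j ∈ p.1, p.2 j • v j with hSdef
  have hS : ∀ (J : Finset (Fin n)) (ε : Fin n → ℤˣ), ∑ j ∈ J, ε j • v j ∈ S := fun J ε =>
    Finset.mem_image.2 ⟨(J, ε), Finset.mem_univ _, rfl⟩
  obtain ⟨κ, _, _, D, hD1, hD2, hD3⟩ := exists_almost_additive_family hL0 hL hc0 hc S hδ
  refine ⟨κ, inferInstance, inferInstance, D, hD1, fun k ε => ?_, fun ε => hD3 _ (hS _ _),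
    fun j => hD3 _ (by simpa using hS {j} 1)⟩
  have hD0 : D k 0 = 0 := norm_le_zero_iff.1 (by simpa using hD1 k 0)
  simpa using norm_sum_signs_sub_le v hS hD0 (hD2 k) ε univ

lemma card_signs (n : ℕ) : Fintype.card (Fin n → ℤˣ) = 2 ^ n := by simp

/-- If `A ≤ B + δ ^ 2 * R` for all positive `δ`, then `A ≤ B`. -/
lemma le_of_forall_le_add_sq_mul {A B R : ℝ} (h : ∀ δ : ℝ, 0 < δ → A ≤ B + δ ^ 2 * R) :
    A ≤ B := by
  have h1 : Filter.Tendsto (fun δ : ℝ => B + δ ^ 2 * R) (nhdsWithin 0 (Set.Ioi 0)) (nhds B) := by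
    have : Continuous fun δ : ℝ => B + δ ^ 2 * R := by fun_prop
    simpa using (this.tendsto 0).mono_left nhdsWithin_le_nhds
  exact ge_of_tendsto h1 (Filter.eventually_of_mem self_mem_nhdsWithin fun δ hδ => h δ hδ)

lemma HasTypeTwo.of_biLipschitz (hY : HasTypeTwo Y C) (hC : 0 ≤ C)
    (hL0 : 0 < L) (hL : ∀ x y, ‖f x - f y‖ ≤ L * ‖x - y‖) (hc0 : 0 < c)
    (hc : ∀ x y, c * ‖x - y‖ ≤ ‖f x - f y‖) : HasTypeTwo X (4 * C * L ^ 2 / c ^ 2) := by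
  intro n v
  suffices h : c ^ 2 * ∑ ε : Fin n → ℤˣ, ‖∑ j, ε j • v j‖ ^ 2
      ≤ 4 * C * L ^ 2 * (2 ^ n * ∑ j, ‖v j‖ ^ 2) by
    rw [div_mul_eq_mul_div, le_div_iff₀ (by positivity)]
    linarith
  refine le_of_forall_le_add_sq_mul (R := 2 ^ n * (16 * n ^ 2 + 2)) fun δ hδ => ?_
  obtain ⟨κ, _, _, D, hD1, hD2, hD3, -⟩ :=
    exists_almost_linear_on_signs hL0 hL hc0.le hc v hδ
  have hκ : (0 : ℝ) < Fintype.card κ := by positivity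
  have h1 : ∀ k, ∑ ε : Fin n → ℤˣ, ‖D k (∑ j, ε j • v j)‖ ^ 2 ≤
      2 * (C * (2 ^ n * (L ^ 2 * ∑ j, ‖v j‖ ^ 2))) + 2 ^ n * (8 * n ^ 2 * δ ^ 2) := by
    intro k
    have e1 : ∑ ε : Fin n → ℤˣ, ‖D k (∑ j, ε j • v j)‖ ^ 2 ≤
        ∑ ε : Fin n → ℤˣ, (2 * ‖∑ j, ε j • D k (v j)‖ ^ 2 + 2 * (n * (2 * δ)) ^ 2) :=
      Finset.sum_le_sum fun ε _ => sq_norm_le_of_norm_sub_le (hD2 k ε)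
    rw [Finset.sum_add_distrib, ← Finset.mul_sum, Finset.sum_const, Finset.card_univ, card_signs,
      nsmul_eq_mul] at e1
    push_cast at e1
    have e2 := hY n fun j => D k (v j)
    have e3 : ∑ j, ‖D k (v j)‖ ^ 2 ≤ L ^ 2 * ∑ j, ‖v j‖ ^ 2 := by
      rw [Finset.mul_sum]
      refine Finset.sum_le_sum fun j _ => ?_
      rw [← mul_pow]
      exact pow_le_pow_left₀ (norm_nonneg _) (hD1 k _) 2
    have e4 : C * (2 ^ n * ∑ j, ‖D k (v j)‖ ^ 2) ≤ C * (2 ^ n * (L ^ 2 * ∑ j, ‖v j‖ ^ 2)) := by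
      gcongr
    nlinarith
  have h2 := Finset.sum_le_sum fun (ε : Fin n → ℤˣ) (_ : ε ∈ univ) => hD3 ε
  rw [Finset.sum_add_distrib, ← Finset.mul_sum, ← Finset.mul_sum, ← Finset.mul_sum,
    Finset.sum_const, Finset.card_univ, card_signs, nsmul_eq_mul, Finset.sum_comm] at h2
  push_cast at h2
  have h3 := Finset.sum_le_sum fun k (_ : k ∈ univ) => h1 k
  rw [Finset.sum_const, Finset.card_univ, nsmul_eq_mul] at h3
  refine le_of_mul_le_mul_left ?_ hκ
  nlinarith

lemma HasCotypeTwo.of_biLipschitz (hY : HasCotypeTwo Y C) (hC : 0 ≤ C)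
    (hL0 : 0 < L) (hL : ∀ x y, ‖f x - f y‖ ≤ L * ‖x - y‖) (hc0 : 0 < c)
    (hc : ∀ x y, c * ‖x - y‖ ≤ ‖f x - f y‖) : HasCotypeTwo X (4 * C * L ^ 2 / c ^ 2) := by
  intro n v
  suffices h : c ^ 2 * (2 ^ n * ∑ j, ‖v j‖ ^ 2)
      ≤ 4 * C * L ^ 2 * ∑ ε : Fin n → ℤˣ, ‖∑ j, ε j • v j‖ ^ 2 by
    rw [div_mul_eq_mul_div, le_div_iff₀ (by positivity)]
    linarith
  refine le_of_forall_le_add_sq_mul (R := 2 ^ n * (C * (16 * n ^ 2) + 2 * n)) fun δ hδ => ?_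
  obtain ⟨κ, _, _, D, hD1, hD2, -, hD3⟩ :=
    exists_almost_linear_on_signs hL0 hL hc0.le hc v hδ
  have hκ : (0 : ℝ) < Fintype.card κ := by positivity
  have h1 : ∀ k, 2 ^ n * ∑ j, ‖D k (v j)‖ ^ 2 ≤
      C * (2 * (L ^ 2 * ∑ ε : Fin n → ℤˣ, ‖∑ j, ε j • v j‖ ^ 2) +
        2 ^ n * (8 * n ^ 2 * δ ^ 2)) := by
    intro k
    have e1 : ∑ ε : Fin n → ℤˣ, ‖∑ j, ε j • D k (v j)‖ ^ 2 ≤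
        ∑ ε : Fin n → ℤˣ, (2 * ‖D k (∑ j, ε j • v j)‖ ^ 2 + 2 * (n * (2 * δ)) ^ 2) :=
      Finset.sum_le_sum fun ε _ => sq_norm_le_of_norm_sub_le (by
        rw [norm_sub_rev]; exact hD2 k ε)
    rw [Finset.sum_add_distrib, ← Finset.mul_sum, Finset.sum_const, Finset.card_univ, card_signs,
      nsmul_eq_mul] at e1
    push_cast at e1
    have e3 : ∑ ε : Fin n → ℤˣ, ‖D k (∑ j, ε j • v j)‖ ^ 2
        ≤ L ^ 2 * ∑ ε : Fin n → ℤˣ, ‖∑ j, ε j • v j‖ ^ 2 := by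
      rw [Finset.mul_sum]
      refine Finset.sum_le_sum fun j _ => ?_
      rw [← mul_pow]
      exact pow_le_pow_left₀ (norm_nonneg _) (hD1 k _) 2
    refine (hY n fun j => D k (v j)).trans (mul_le_mul_of_nonneg_left ?_ hC)
    nlinarith
  have h2 := Finset.sum_le_sum fun (j : Fin n) (_ : j ∈ univ) => hD3 j
  rw [Finset.sum_add_distrib, ← Finset.mul_sum, ← Finset.mul_sum, ← Finset.mul_sum,
    Finset.sum_const, Finset.card_univ, Fintype.card_fin, nsmul_eq_mul, Finset.sum_comm] at h2
  have h3 := Finset.sum_le_sum fun k (_ : k ∈ univ) => h1 k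
  rw [Finset.sum_const, Finset.card_univ, nsmul_eq_mul, ← Finset.mul_sum] at h3
  have h4 := mul_le_mul_of_nonneg_left h2 (show (0 : ℝ) ≤ 2 ^ n by positivity)
  refine le_of_mul_le_mul_left ?_ hκ
  nlinarith

end Rademacher

section Lebesgue

variable {Ω : Type*} [MeasurableSpace Ω] {μ : Measure Ω} {p : ℝ≥0∞}

lemma Lp_norm_rpow_eq_integral (hp0 : p ≠ 0) (hp : p ≠ ∞) (f : Lp ℝ p μ) :
    ‖f‖ ^ p.toReal = ∫ ω, |f ω| ^ p.toReal ∂μ := by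
  have hpos := ENNReal.toReal_pos hp0 hp
  rw [Lp.norm_def, (Lp.memLp f).eLpNorm_eq_integral_rpow_norm hp0 hp, ENNReal.toReal_ofReal,
    ← Real.rpow_mul, inv_mul_cancel₀ hpos.ne', Real.rpow_one]
  · rfl
  all_goals positivity

lemma Lp_integrable_abs_rpow (hp0 : p ≠ 0) (hp : p ≠ ∞) (f : Lp ℝ p μ) :
    Integrable (fun ω => |f ω| ^ p.toReal) μ :=
  (Lp.memLp f).integrable_norm_rpow hp0 hp

lemma add_rpow_le_of_weights {A B x y s : ℝ} (hA : 0 < A) (hB : 0 < B) (hx : 0 ≤ x) (hy : 0 ≤ y)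
    (hs : 1 ≤ s) :
    (x + y) ^ s ≤ (A + B) ^ s * (A / (A + B) * (x ^ s / A ^ s) + B / (A + B) * (y ^ s / B ^ s)) := by
  have h := (convexOn_rpow hs).2 (Set.mem_Ici.2 (div_nonneg hx hA.le))
    (Set.mem_Ici.2 (div_nonneg hy hB.le)) (show 0 ≤ A / (A + B) by positivity)
    (show 0 ≤ B / (A + B) by positivity) (by field_simp)
  simp only [smul_eq_mul] at h
  rw [Real.div_rpow hx hA.le, Real.div_rpow hy hB.le] at h
  have e : x + y = (A + B) * (A / (A + B) * (x / A) + B / (A + B) * (y / B)) := by field_simp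
  rw [e, Real.mul_rpow (by positivity) (by positivity)]
  gcongr

lemma two_point_even_pow (a b : ℝ) (k : ℕ) :
    (a + b) ^ (2 * k) + (a - b) ^ (2 * k) ≤ 2 * (a ^ 2 + (8 * k + 1) * b ^ 2) ^ k := by
  suffices h : ∀ j ≤ k, (a + b) ^ (2 * j) + (a - b) ^ (2 * j)
      ≤ 2 * (a ^ 2 + (8 * k + 1) * b ^ 2) ^ j from h k le_rfl
  intro j
  induction j with
  | zero => intro _; norm_num
  | succ j ih =>
    intro hj
    have ih := ih (by omega)
    rw [pow_mul, pow_mul] at ih ⊢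
    set U := (a + b) ^ 2 with hU
    set V := (a - b) ^ 2 with hV
    have hU0 : 0 ≤ U := sq_nonneg _
    have hV0 : 0 ≤ V := sq_nonneg _
    have hM : a ^ 2 ≤ max U V := by
      nlinarith [le_max_left U V, le_max_right U V, sq_nonneg b]
    have hM0 : 0 ≤ max U V := le_max_of_le_left hU0
    have h1 : (U - V) * (U ^ j - V ^ j) ≤ 16 * j * b ^ 2 * (U ^ j + V ^ j) := by
      have e1 := abs_pow_sub_pow_le U V j
      rw [abs_of_nonneg hU0, abs_of_nonneg hV0] at e1
      have e2 : (max U V) ^ j ≤ U ^ j + V ^ j := by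
        rcases max_choice U V with h | h <;> rw [h]
        · linarith [pow_nonneg hV0 j]
        · linarith [pow_nonneg hU0 j]
      rcases j with _ | j
      · simp
      calc (U - V) * (U ^ (j + 1) - V ^ (j + 1))
          ≤ |U - V| * |U ^ (j + 1) - V ^ (j + 1)| := by
            rw [← abs_mul]; exact le_abs_self _
        _ ≤ |U - V| * (|U - V| * (j + 1 : ℕ) * max U V ^ (j + 1 - 1)) := by gcongr
        _ = 16 * (j + 1 : ℕ) * b ^ 2 * (a ^ 2 * max U V ^ j) := by
            rw [Nat.add_sub_cancel]
            have : |U - V| * |U - V| = 16 * a ^ 2 * b ^ 2 := by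
              rw [abs_mul_abs_self, hU, hV]; ring
            linear_combination ((j + 1 : ℕ) * max U V ^ j) * this
        _ ≤ 16 * (j + 1 : ℕ) * b ^ 2 * (max U V * max U V ^ j) := by gcongr
        _ ≤ 16 * (j + 1 : ℕ) * b ^ 2 * (U ^ (j + 1) + V ^ (j + 1)) := by
            rw [← pow_succ']; gcongr
    have h2 : U ^ (j + 1) + V ^ (j + 1) ≤ (a ^ 2 + (8 * k + 1) * b ^ 2) * (U ^ j + V ^ j) := by
      have e1 : U ^ (j + 1) + V ^ (j + 1) =
          (a ^ 2 + b ^ 2) * (U ^ j + V ^ j) + (U - V) * (U ^ j - V ^ j) / 2 := by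
        have : a ^ 2 + b ^ 2 = (U + V) / 2 := by rw [hU, hV]; ring
        rw [this]; ring
      have e2 : (j : ℝ) ≤ k := by exact_mod_cast (by omega : j ≤ k)
      have e3 : 0 ≤ b ^ 2 * (U ^ j + V ^ j) := by positivity
      nlinarith [mul_le_mul_of_nonneg_right e2 e3]
    calc U ^ (j + 1) + V ^ (j + 1) ≤ (a ^ 2 + (8 * k + 1) * b ^ 2) * (U ^ j + V ^ j) := h2
      _ ≤ (a ^ 2 + (8 * k + 1) * b ^ 2) * (2 * (a ^ 2 + (8 * k + 1) * b ^ 2) ^ j) := by gcongr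
      _ = _ := by ring

/-- Convexity of `t ↦ t ^ s` at the midpoint. -/
lemma half_add_rpow_le {x y s : ℝ} (hx : 0 ≤ x) (hy : 0 ≤ y) (hs : 1 ≤ s) :
    ((x + y) / 2) ^ s ≤ (x ^ s + y ^ s) / 2 := by
  have h := (convexOn_rpow hs).2 (Set.mem_Ici.2 hx) (Set.mem_Ici.2 hy)
    (show (0 : ℝ) ≤ 1 / 2 by norm_num) (show (0 : ℝ) ≤ 1 / 2 by norm_num) (by norm_num)
  simp only [smul_eq_mul] at h
  rw [show (x + y) / 2 = 1 / 2 * x + 1 / 2 * y by ring]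
  linarith

lemma exists_two_point_rpow {r : ℝ} (hr : 2 ≤ r) :
    ∃ K : ℝ, 0 < K ∧ ∀ a b : ℝ,
      (|a + b| ^ r + |a - b| ^ r) / 2 ≤ (a ^ 2 + K * b ^ 2) ^ (r / 2) := by
  obtain ⟨k, hk⟩ := exists_nat_ge (r / 2)
  refine ⟨8 * k + 1, by positivity, fun a b => ?_⟩
  have hr0 : 0 < r := by linarith
  have hk0 : (0 : ℝ) < k := by linarith
  have h1 := half_add_rpow_le (x := |a + b| ^ r) (y := |a - b| ^ r) (s := 2 * k / r)
    (by positivity) (by positivity) (by rw [le_div_iff₀ hr0]; linarith)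
  have h2 : ∀ x : ℝ, (|x| ^ r) ^ (2 * k / r) = x ^ (2 * k) := by
    intro x
    rw [← Real.rpow_mul (abs_nonneg _), mul_div_cancel₀ _ hr0.ne',
      show (2 * k : ℝ) = ((2 * k : ℕ) : ℝ) by push_cast; ring, Real.rpow_natCast, pow_mul, sq_abs,
      ← pow_mul]
  rw [h2, h2] at h1
  have h3 : ((|a + b| ^ r + |a - b| ^ r) / 2) ^ (2 * k / r) ≤ (a ^ 2 + (8 * k + 1) * b ^ 2) ^ k :=
    h1.trans (by linarith [two_point_even_pow a b k])
  have h4 := Real.rpow_le_rpow (by positivity) h3 (show 0 ≤ r / (2 * k) by positivity)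
  rw [← Real.rpow_mul (by positivity), ← Real.rpow_natCast, ← Real.rpow_mul (by positivity)] at h4
  rw [show 2 * (k : ℝ) / r * (r / (2 * k)) = 1 by field_simp, Real.rpow_one,
    show (k : ℝ) * (r / (2 * k)) = r / 2 by field_simp] at h4
  exact h4

/-- `L^q` is 2-uniformly smooth for `2 ≤ q < ∞`. -/
lemma exists_Lp_smooth [Fact (1 ≤ p)] (hp2 : 2 ≤ p) (hp : p ≠ ∞) :
    ∃ K : ℝ, 0 < K ∧ ∀ f h : Lp ℝ p μ,
      ‖f + h‖ ^ 2 + ‖f - h‖ ^ 2 ≤ 2 * (‖f‖ ^ 2 + K * ‖h‖ ^ 2) := by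
  have hp0 : p ≠ 0 := (two_pos.trans_le hp2).ne'
  set r := p.toReal with hr
  have hr2 : 2 ≤ r := by simpa using ENNReal.toReal_mono hp hp2
  obtain ⟨K, hK0, hK⟩ := exists_two_point_rpow hr2
  refine ⟨K, hK0, fun f h => ?_⟩
  have hs : 1 ≤ r / 2 := by linarith
  have hsq : ∀ x : ℝ, (x ^ 2) ^ (r / 2) = |x| ^ r := fun x => by
    rw [← sq_abs, ← Real.rpow_natCast, ← Real.rpow_mul (abs_nonneg _)]
    congr 1; push_cast; ring
  suffices H : ∀ η : ℝ, 0 < η →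
      ‖f + h‖ ^ 2 + ‖f - h‖ ^ 2 ≤ 2 * (‖f‖ ^ 2 + K * ‖h‖ ^ 2) + η ^ 2 * 4 from
    le_of_forall_le_add_sq_mul H
  intro η hη
  set A := ‖f‖ ^ 2 + η ^ 2 with hA
  set B := K * ‖h‖ ^ 2 + η ^ 2 with hB
  have hA0 : 0 < A := by positivity
  have hB0 : 0 < B := by positivity
  have hInt := fun g : Lp ℝ p μ => Lp_integrable_abs_rpow hp0 hp g
  have hnorm := fun g : Lp ℝ p μ => Lp_norm_rpow_eq_integral hp0 hp g
  rw [← hr] at hInt hnorm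
  have h1 : (‖f + h‖ ^ r + ‖f - h‖ ^ r) / 2 ≤ (A + B) ^ (r / 2) *
      (A / (A + B) * (‖f‖ ^ r / A ^ (r / 2)) +
        B / (A + B) * (K ^ (r / 2) * ‖h‖ ^ r / B ^ (r / 2))) := by
    simp only [hnorm]
    rw [← integral_add (hInt _) (hInt _), ← integral_div, ← integral_div, ← integral_const_mul,
      ← integral_const_mul, ← integral_div, ← integral_const_mul, ← integral_add, ← integral_const_mul]
    · refine integral_mono_ae (((hInt _).add (hInt _)).div_const 2) (Integrable.const_mul
        ((((hInt _).div_const _).const_mul _).add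
          ((((hInt _).const_mul _).div_const _).const_mul _)) _) ?_
      filter_upwards [Lp.coeFn_add f h, Lp.coeFn_sub f h] with ω e1 e2
      simp only [Pi.add_apply, Pi.sub_apply] at e1 e2
      simp only [e1, e2]
      refine (hK _ _).trans ?_
      have := add_rpow_le_of_weights hA0 hB0 (sq_nonneg (f ω))
        (show 0 ≤ K * h ω ^ 2 by positivity) hs
      rwa [Real.mul_rpow hK0.le (sq_nonneg _), hsq, hsq] at this
    · exact ((hInt _).div_const _).const_mul _
    · exact (((hInt _).const_mul _).div_const _).const_mul _
  have h2 : ‖f‖ ^ r / A ^ (r / 2) ≤ 1 := by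
    rw [div_le_one (by positivity), ← abs_of_nonneg (norm_nonneg f), ← hsq]
    exact Real.rpow_le_rpow (by positivity) (by rw [hA]; nlinarith) (by positivity)
  have h3 : K ^ (r / 2) * ‖h‖ ^ r / B ^ (r / 2) ≤ 1 := by
    rw [div_le_one (by positivity), ← abs_of_nonneg (norm_nonneg h), ← hsq,
      ← Real.mul_rpow hK0.le (by positivity)]
    exact Real.rpow_le_rpow (by positivity) (by rw [hB]; nlinarith) (by positivity)
  have h4 : A / (A + B) * (‖f‖ ^ r / A ^ (r / 2)) +
        B / (A + B) * (K ^ (r / 2) * ‖h‖ ^ r / B ^ (r / 2)) ≤ 1 := by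
    calc _ ≤ A / (A + B) * 1 + B / (A + B) * 1 := by gcongr
      _ = 1 := by field_simp
  have h5 := half_add_rpow_le (sq_nonneg ‖f + h‖) (sq_nonneg ‖f - h‖) hs
  rw [hsq, hsq, abs_norm, abs_norm] at h5
  have h6 : ((‖f + h‖ ^ 2 + ‖f - h‖ ^ 2) / 2) ^ (r / 2) ≤ (A + B) ^ (r / 2) :=
    h5.trans (h1.trans (mul_le_of_le_one_right (by positivity) h4))
  have h7 := (Real.rpow_le_rpow_iff (by positivity) (by positivity) (by positivity)).1 h6
  rw [hA, hB] at h7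
  linarith

lemma hasTypeTwo_of_smooth {E : Type*} [NormedAddCommGroup E] {K : ℝ}
    (hK : ∀ x y : E, ‖x + y‖ ^ 2 + ‖x - y‖ ^ 2 ≤ 2 * (‖x‖ ^ 2 + K * ‖y‖ ^ 2)) :
    HasTypeTwo E K := by
  intro n
  induction n with
  | zero => intro v; simp
  | succ n ih =>
    intro v
    rw [sum_signs_succ v fun x => ‖x‖ ^ 2]
    calc _ ≤ ∑ ε : Fin n → ℤˣ, 2 * (‖∑ j, ε j • v j.succ‖ ^ 2 + K * ‖v 0‖ ^ 2) :=
          Finset.sum_le_sum fun ε _ => hK _ _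
      _ = 2 * (∑ ε : Fin n → ℤˣ, ‖∑ j, ε j • v j.succ‖ ^ 2) + 2 * 2 ^ n * (K * ‖v 0‖ ^ 2) := by
          rw [← Finset.mul_sum, Finset.sum_add_distrib, Finset.sum_const, Finset.card_univ,
            card_signs, nsmul_eq_mul]
          push_cast; ring
      _ ≤ _ := by
          rw [Fin.sum_univ_succ, pow_succ (2 : ℝ) n]
          linarith [ih fun j => v j.succ]

lemma exists_Lp_hasTypeTwo [Fact (1 ≤ p)] (hp2 : 2 ≤ p) (hp : p ≠ ∞) :
    ∃ K : ℝ, 0 < K ∧ HasTypeTwo (Lp ℝ p μ) K := by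
  obtain ⟨K, hK0, hK⟩ := exists_Lp_smooth (μ := μ) hp2 hp
  exact ⟨K, hK0, hasTypeTwo_of_smooth hK⟩

lemma sum_signs_sq {n : ℕ} (a : Fin n → ℝ) :
    ∑ ε : Fin n → ℤˣ, (∑ j, ε j • a j) ^ 2 = 2 ^ n * ∑ j, a j ^ 2 := by
  induction n with
  | zero => simp
  | succ n ih =>
    rw [sum_signs_succ a fun x => x ^ 2]
    calc _ = ∑ ε : Fin n → ℤˣ, (2 * (∑ j, ε j • a j.succ) ^ 2 + 2 * a 0 ^ 2) :=
          Finset.sum_congr rfl fun ε _ => by ring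
      _ = _ := by
          rw [Finset.sum_add_distrib, ← Finset.mul_sum, ih, Finset.sum_const, Finset.card_univ,
            card_signs, nsmul_eq_mul, Fin.sum_univ_succ]
          push_cast; ring

lemma sum_signs_pow_four_le {n : ℕ} (a : Fin n → ℝ) :
    ∑ ε : Fin n → ℤˣ, (∑ j, ε j • a j) ^ 4 ≤ 3 * (2 ^ n * (∑ j, a j ^ 2) ^ 2) := by
  induction n with
  | zero => simp
  | succ n ih =>
    rw [sum_signs_succ a fun x => x ^ 4]
    calc _ = ∑ ε : Fin n → ℤˣ, (2 * (∑ j, ε j • a j.succ) ^ 4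
            + 12 * a 0 ^ 2 * (∑ j, ε j • a j.succ) ^ 2 + 2 * a 0 ^ 4) :=
          Finset.sum_congr rfl fun ε _ => by ring
      _ = 2 * (∑ ε : Fin n → ℤˣ, (∑ j, ε j • a j.succ) ^ 4)
            + 12 * a 0 ^ 2 * (2 ^ n * ∑ j : Fin n, a j.succ ^ 2) + 2 ^ n * (2 * a 0 ^ 4) := by
          rw [Finset.sum_add_distrib, Finset.sum_add_distrib, ← Finset.mul_sum, ← Finset.mul_sum,
            sum_signs_sq, Finset.sum_const, Finset.card_univ, card_signs, nsmul_eq_mul]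
          push_cast; ring
      _ ≤ _ := by
          have h : 0 ≤ (2 : ℝ) ^ n * a 0 ^ 4 := by positivity
          rw [Fin.sum_univ_succ, pow_succ (2 : ℝ) n]
          nlinarith [ih fun j => a j.succ]

/-- The lower Khintchine inequality in `L^1`. -/
lemma khintchine_lower {n : ℕ} (a : Fin n → ℝ) :
    ∑ j, a j ^ 2 ≤ (2 * ((2 ^ n)⁻¹ * ∑ ε : Fin n → ℤˣ, |∑ j, ε j • a j|)) ^ 2 := by
  set σ := √(∑ j, a j ^ 2) with hσ
  have hσ2 : σ ^ 2 = ∑ j, a j ^ 2 := Real.sq_sqrt (by positivity)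
  have hσ0 : 0 ≤ σ := Real.sqrt_nonneg _
  rw [← hσ2]
  refine pow_le_pow_left₀ hσ0 ?_ 2
  rcases hσ0.eq_or_lt with h0 | hpos
  · rw [← h0]; positivity
  have hpt : ∀ x : ℝ, 6 * σ ^ 2 * x ^ 2 ≤ 6 * σ ^ 3 * |x| + x ^ 4 := by
    intro x
    rw [← sq_abs x, show x ^ 4 = |x| ^ 4 by rw [← abs_pow, abs_of_nonneg (by positivity)]]
    have hx := abs_nonneg x
    set t := |x|
    have : 0 ≤ t ^ 3 - 6 * σ ^ 2 * t + 6 * σ ^ 3 := by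
      have e1 : 0 ≤ (t - 1.42 * σ) ^ 2 * (t + 2.84 * σ) := by positivity
      have e2 : 0 ≤ σ ^ 2 * t := by positivity
      have e3 : 0 ≤ σ ^ 3 := by positivity
      nlinarith
    nlinarith [mul_nonneg hx this]
  have h1 := Finset.sum_le_sum fun (ε : Fin n → ℤˣ) (_ : ε ∈ univ) => hpt (∑ j, ε j • a j)
  rw [Finset.sum_add_distrib, ← Finset.mul_sum, ← Finset.mul_sum, sum_signs_sq, ← hσ2] at h1
  have h2 := sum_signs_pow_four_le a
  rw [← hσ2] at h2
  have h3 : σ ^ 3 * (2 ^ n * σ) ≤ σ ^ 3 * (2 * ∑ ε : Fin n → ℤˣ, |∑ j, ε j • a j|) := by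
    nlinarith
  have h4 := le_of_mul_le_mul_left h3 (by positivity)
  rw [mul_left_comm, le_inv_mul_iff₀ (by positivity)]
  exact h4

/-- Minkowski's inequality between `ℓ^2(L^p)` and `L^p(ℓ^2)` for `p ≤ 2`. -/
lemma sum_sq_norm_le_of_ae_le [Fact (1 ≤ p)] (hp2 : p ≤ 2) {n : ℕ} (v : Fin n → Lp ℝ p μ)
    (w : Lp ℝ p μ) (h : ∀ᵐ ω ∂μ, ∑ j, v j ω ^ 2 ≤ w ω ^ 2) :
    ∑ j, ‖v j‖ ^ 2 ≤ ‖w‖ ^ 2 := by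
  have hp1 : 1 ≤ p := Fact.out
  have hp0 : p ≠ 0 := (one_pos.trans_le hp1).ne'
  have hp : p ≠ ∞ := (hp2.trans_lt (by simp)).ne
  set r := p.toReal with hr
  have hr2 : r ≤ 2 := by simpa using ENNReal.toReal_mono (by simp) hp2
  have hr0 : 0 < r := ENNReal.toReal_pos hp0 hp
  have hsq : ∀ x : ℝ, (x ^ 2) ^ (r / 2) = |x| ^ r := fun x => by
    rw [← sq_abs, ← Real.rpow_natCast, ← Real.rpow_mul (abs_nonneg _)]
    congr 1; push_cast; ring
  have hInt := fun g : Lp ℝ p μ => Lp_integrable_abs_rpow hp0 hp g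
  have hnorm := fun g : Lp ℝ p μ => Lp_norm_rpow_eq_integral hp0 hp g
  rw [← hr] at hInt hnorm
  set T := ∑ j, ‖v j‖ ^ 2 with hT
  have hT0 : 0 ≤ T := by positivity
  rcases hT0.eq_or_lt with h0 | hTpos
  · rw [← h0]; positivity
  have hpt : ∀ x : Fin n → ℝ, T ^ (r / 2) * ∑ j, ‖v j‖ ^ 2 / T * (|x j| ^ r / ‖v j‖ ^ r)
      ≤ (∑ j, x j ^ 2) ^ (r / 2) := by
    intro x
    have h1 := (Real.concaveOn_rpow (p := r / 2) (by positivity) (by linarith)).le_map_sum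
      (t := univ) (w := fun j => ‖v j‖ ^ 2 / T) (p := fun j => x j ^ 2 / ‖v j‖ ^ 2)
      (fun j _ => by positivity) (by rw [← Finset.sum_div, div_self hTpos.ne'])
      (fun j _ => Set.mem_Ici.2 (by positivity))
    simp only [smul_eq_mul] at h1
    calc _ = T ^ (r / 2) * ∑ j, ‖v j‖ ^ 2 / T * (x j ^ 2 / ‖v j‖ ^ 2) ^ (r / 2) := by
          congr 1
          refine Finset.sum_congr rfl fun j _ => ?_
          rw [Real.div_rpow (sq_nonneg _) (sq_nonneg _), hsq, hsq, abs_norm]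
      _ ≤ T ^ (r / 2) * (∑ j, ‖v j‖ ^ 2 / T * (x j ^ 2 / ‖v j‖ ^ 2)) ^ (r / 2) := by gcongr
      _ = (∑ j, T * (‖v j‖ ^ 2 / T * (x j ^ 2 / ‖v j‖ ^ 2))) ^ (r / 2) := by
          rw [← Real.mul_rpow hT0 (by positivity), Finset.mul_sum]
      _ ≤ _ := by
          refine Real.rpow_le_rpow (by positivity) (Finset.sum_le_sum fun j _ => ?_) (by positivity)
          rcases eq_or_ne ‖v j‖ 0 with hj | hj
          · rw [hj]; simp; positivity
          · apply le_of_eq; field_simp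
  have h1 : T ^ (r / 2) * ∑ j, ‖v j‖ ^ 2 / T * (‖v j‖ ^ r / ‖v j‖ ^ r) ≤ ‖w‖ ^ r := by
    have e : ∀ j, ‖v j‖ ^ 2 / T * (‖v j‖ ^ r / ‖v j‖ ^ r) =
        ∫ ω, ‖v j‖ ^ 2 / T * (|v j ω| ^ r / ‖v j‖ ^ r) ∂μ := by
      intro j
      rw [integral_const_mul, integral_div, ← hnorm]
    rw [hnorm w, Finset.sum_congr rfl fun j _ => e j,
      ← integral_finsetSum _ fun j _ => ((hInt _).div_const _).const_mul _, ← integral_const_mul]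
    refine integral_mono_ae (Integrable.const_mul (integrable_finsetSum _ fun j _ =>
      ((hInt _).div_const _).const_mul _) _) (hInt w) ?_
    filter_upwards [h] with ω hω
    rw [← hsq (w ω)]
    exact (hpt fun j => v j ω).trans (Real.rpow_le_rpow (by positivity) hω (by positivity))
  have h2 : ∑ j, ‖v j‖ ^ 2 / T * (‖v j‖ ^ r / ‖v j‖ ^ r) = 1 := by
    rw [← div_self hTpos.ne']
    conv_rhs => rw [hT, Finset.sum_div]
    refine Finset.sum_congr rfl fun j _ => ?_
    rcases eq_or_ne ‖v j‖ 0 with hj | hj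
    · rw [hj]; simp
    · rw [div_self (by positivity), mul_one]
  rw [h2, mul_one, ← abs_norm w, ← hsq] at h1
  exact (Real.rpow_le_rpow_iff hT0 (by positivity) (by positivity)).1 h1

lemma Lp_hasCotypeTwo [Fact (1 ≤ p)] (hp2 : p ≤ 2) : HasCotypeTwo (Lp ℝ p μ) 4 := by
  intro n v
  set w : Lp ℝ p μ := (2 : ℝ) • ((2 ^ n)⁻¹ : ℝ) • ∑ ε : Fin n → ℤˣ, |∑ j, ε j • v j| with hw
  have hsmul : ∀ (u : ℤˣ) (f : Lp ℝ p μ), ∀ᵐ ω ∂μ, (u • f) ω = u • f ω := by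
    intro u f
    rcases Int.units_eq_one_or u with rfl | rfl
    · simp
    · filter_upwards [Lp.coeFn_neg f] with ω h
      simpa using h
  have hsum : ∀ ε : Fin n → ℤˣ, ∀ᵐ ω ∂μ, (∑ j, ε j • v j) ω = ∑ j, ε j • v j ω := by
    intro ε
    filter_upwards [Lp.coeFn_finsetSum univ fun j => ε j • v j,
      ae_all_iff.2 fun j => hsmul (ε j) (v j)] with ω h1 h2
    rw [h1, Finset.sum_apply]
    exact Finset.sum_congr rfl fun j _ => h2 j
  have hwω : ∀ᵐ ω ∂μ, ∑ j, v j ω ^ 2 ≤ w ω ^ 2 := by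
    filter_upwards [ae_all_iff.2 hsum, Lp.coeFn_smul (2 : ℝ) (((2 ^ n)⁻¹ : ℝ) •
      ∑ ε : Fin n → ℤˣ, |∑ j, ε j • v j|), Lp.coeFn_smul ((2 ^ n)⁻¹ : ℝ)
      (∑ ε : Fin n → ℤˣ, |∑ j, ε j • v j|),
      Lp.coeFn_finsetSum univ fun ε : Fin n → ℤˣ => |∑ j, ε j • v j|,
      ae_all_iff.2 fun ε : Fin n → ℤˣ => Lp.coeFn_abs (∑ j, ε j • v j)] with ω h1 h2 h3 h4 h5
    rw [hw, h2, Pi.smul_apply, h3, Pi.smul_apply, h4]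
    simp only [Finset.sum_apply, h5, h1, smul_eq_mul]
    exact khintchine_lower fun j => v j ω
  have h1 := sum_sq_norm_le_of_ae_le hp2 v w hwω
  have h2 : ‖w‖ ≤ 2 * ((2 ^ n)⁻¹ * ∑ ε : Fin n → ℤˣ, ‖∑ j, ε j • v j‖) := by
    rw [hw, norm_smul, norm_smul, Real.norm_of_nonneg (by positivity),
      Real.norm_of_nonneg (by positivity)]
    gcongr
    exact norm_sum_le_of_le _ fun ε _ => (norm_abs_eq_norm _).le
  have h3 : (∑ ε : Fin n → ℤˣ, ‖∑ j, ε j • v j‖) ^ 2 ≤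
      2 ^ n * ∑ ε : Fin n → ℤˣ, ‖∑ j, ε j • v j‖ ^ 2 := by
    have := sq_sum_le_card_mul_sum_sq (s := univ) (f := fun ε : Fin n → ℤˣ => ‖∑ j, ε j • v j‖)
    rwa [Finset.card_univ, card_signs, Nat.cast_pow, Nat.cast_ofNat] at this
  calc 2 ^ n * ∑ j, ‖v j‖ ^ 2
      ≤ 2 ^ n * (2 * ((2 ^ n)⁻¹ * ∑ ε : Fin n → ℤˣ, ‖∑ j, ε j • v j‖)) ^ 2 := by
        gcongr; exact h1.trans (pow_le_pow_left₀ (norm_nonneg _) h2 2)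
    _ = 4 * (2 ^ n)⁻¹ * (∑ ε : Fin n → ℤˣ, ‖∑ j, ε j • v j‖) ^ 2 := by field_simp; ring
    _ ≤ 4 * (2 ^ n)⁻¹ * (2 ^ n * ∑ ε : Fin n → ℤˣ, ‖∑ j, ε j • v j‖ ^ 2) := by gcongr
    _ = _ := by field_simp

end Lebesgue

section Gaussian

open ProbabilityTheory

/-- The standard Gaussian measure on `ℝ ^ n`. -/
noncomputable def gaussianPi (n : ℕ) : Measure (Fin n → ℝ) :=
  Measure.pi fun _ => gaussianReal 0 1

instance (n : ℕ) : IsProbabilityMeasure (gaussianPi n) := by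
  unfold gaussianPi; infer_instance

lemma integrable_sq_gaussianPi {n : ℕ} (j : Fin n) :
    Integrable (fun g : Fin n → ℝ => g j ^ 2) (gaussianPi n) :=
  (measurePreserving_eval (fun _ : Fin n => gaussianReal 0 1) j).integrable_comp_of_integrable
    ((memLp_id_gaussianReal' 2 (by simp)).integrable_sq)

lemma integral_sq_gaussianPi {n : ℕ} (j : Fin n) : ∫ g, g j ^ 2 ∂gaussianPi n = 1 := by
  have h := (measurePreserving_eval (fun _ : Fin n => gaussianReal 0 1) j)
  have h2 : ∫ x, x ^ 2 ∂gaussianReal 0 1 = 1 := by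
    have := variance_fun_id_gaussianReal (μ := 0) (v := 1)
    rwa [variance_of_integral_eq_zero (by fun_prop) integral_id_gaussianReal, NNReal.coe_one] at this
  rw [← h2, ← h.map_eq, integral_map (measurable_pi_apply j).aemeasurable
    (Continuous.aestronglyMeasurable (by fun_prop))]
  rfl

lemma measurePreserving_signs {n : ℕ} (ε : Fin n → ℤˣ) :
    MeasurePreserving (fun (g : Fin n → ℝ) j => ε j • g j) (gaussianPi n) (gaussianPi n) := by
  have h : ∀ u : ℤˣ, MeasurePreserving (fun x : ℝ => u • x) (gaussianReal 0 1)
      (gaussianReal 0 1) := by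
    intro u
    rcases Int.units_eq_one_or u with rfl | rfl
    · simp only [one_smul]
      exact MeasurePreserving.id _
    · simp only [Units.neg_smul, one_smul]
      exact ⟨measurable_neg, by simp [gaussianReal_map_neg]⟩
  exact measurePreserving_pi _ _ fun j => h (ε j)

variable {E : Type*} [NormedAddCommGroup E] [NormedSpace ℝ E] {C : ℝ}

/-- The second moment of the norm of the Gaussian vector `∑ g j • v j`. -/
noncomputable def gaussianSq {n : ℕ} (v : Fin n → E) : ℝ :=
  ∫ g, ‖∑ j, g j • v j‖ ^ 2 ∂gaussianPi n

lemma integrable_gaussianSq {n : ℕ} (v : Fin n → E) :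
    Integrable (fun g : Fin n → ℝ => ‖∑ j, g j • v j‖ ^ 2) (gaussianPi n) := by
  refine Integrable.mono' (g := fun g : Fin n → ℝ => n * ∑ j, g j ^ 2 * ‖v j‖ ^ 2)
    ((integrable_finsetSum _ fun j _ => (integrable_sq_gaussianPi j).mul_const _).const_mul _)
    (Continuous.aestronglyMeasurable (by fun_prop)) (ae_of_all _ fun g => ?_)
  rw [Real.norm_of_nonneg (by positivity)]
  calc _ ≤ (∑ j, ‖g j • v j‖) ^ 2 := pow_le_pow_left₀ (norm_nonneg _) (norm_sum_le _ _) 2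
    _ ≤ n * ∑ j, ‖g j • v j‖ ^ 2 := by
      simpa using sq_sum_le_card_mul_sum_sq (s := univ) (f := fun j => ‖g j • v j‖)
    _ = _ := by simp [norm_smul, mul_pow]

lemma two_pow_mul_gaussianSq {n : ℕ} (v : Fin n → E) :
    2 ^ n * gaussianSq v = ∫ g, ∑ ε : Fin n → ℤˣ, ‖∑ j, ε j • g j • v j‖ ^ 2 ∂gaussianPi n ∧
    Integrable (fun g : Fin n → ℝ => ∑ ε : Fin n → ℤˣ, ‖∑ j, ε j • g j • v j‖ ^ 2)
      (gaussianPi n) := by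
  have hi : ∀ ε : Fin n → ℤˣ,
      Integrable (fun g : Fin n → ℝ => ‖∑ j, ε j • g j • v j‖ ^ 2) (gaussianPi n) := by
    intro ε
    simpa only [Function.comp_def, smul_assoc] using
      (measurePreserving_signs ε).integrable_comp_of_integrable (integrable_gaussianSq v)
  refine ⟨?_, integrable_finsetSum _ fun ε _ => hi ε⟩
  rw [integral_finsetSum _ fun ε _ => hi ε]
  have h : ∀ ε : Fin n → ℤˣ, ∫ g, ‖∑ j, ε j • g j • v j‖ ^ 2 ∂gaussianPi n = gaussianSq v := by
    intro ε
    rw [gaussianSq]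
    conv_rhs => rw [← (measurePreserving_signs ε).map_eq]
    rw [integral_map (measurePreserving_signs ε).aemeasurable
      (Continuous.aestronglyMeasurable (by fun_prop))]
    simp only [smul_assoc]
  rw [Finset.sum_congr rfl fun ε _ => h ε, Finset.sum_const, Finset.card_univ, card_signs,
    nsmul_eq_mul]
  push_cast; rfl

lemma integral_sum_sq_norm {n : ℕ} (v : Fin n → E) :
    ∫ g, ∑ j, ‖g j • v j‖ ^ 2 ∂gaussianPi n = ∑ j, ‖v j‖ ^ 2 ∧
    Integrable (fun g : Fin n → ℝ => ∑ j, ‖g j • v j‖ ^ 2) (gaussianPi n) := by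
  simp only [norm_smul, mul_pow, Real.norm_eq_abs, sq_abs]
  have hi := fun j : Fin n => (integrable_sq_gaussianPi j).mul_const (‖v j‖ ^ 2)
  refine ⟨?_, integrable_finsetSum _ fun j _ => hi j⟩
  rw [integral_finsetSum _ fun j _ => hi j]
  simp [integral_mul_const, integral_sq_gaussianPi]

lemma HasTypeTwo.gaussianSq_le (h : HasTypeTwo E C) {n : ℕ} (v : Fin n → E) :
    gaussianSq v ≤ C * ∑ j, ‖v j‖ ^ 2 := by
  obtain ⟨h1, h2⟩ := two_pow_mul_gaussianSq v
  obtain ⟨h3, h4⟩ := integral_sum_sq_norm v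
  refine le_of_mul_le_mul_left (a := (2 : ℝ) ^ n) ?_ (by positivity)
  rw [h1, ← h3, mul_left_comm, ← integral_const_mul, ← integral_const_mul]
  exact integral_mono h2 ((h4.const_mul _).const_mul _) fun g => h n _

lemma HasCotypeTwo.le_gaussianSq (h : HasCotypeTwo E C) {n : ℕ} (v : Fin n → E) :
    ∑ j, ‖v j‖ ^ 2 ≤ C * gaussianSq v := by
  obtain ⟨h1, h2⟩ := two_pow_mul_gaussianSq v
  obtain ⟨h3, h4⟩ := integral_sum_sq_norm v
  refine le_of_mul_le_mul_left (a := (2 : ℝ) ^ n) ?_ (by positivity)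
  rw [mul_left_comm, h1, ← h3, ← integral_const_mul, ← integral_const_mul]
  exact integral_mono (h4.const_mul _) (h2.const_mul _) fun g => h n _

lemma charFunDual_gaussianPi_map [MeasurableSpace E] [BorelSpace E] {n : ℕ} (v : Fin n → E)
    (φ : StrongDual ℝ E) :
    charFunDual ((gaussianPi n).map fun g => ∑ j, g j • v j) φ =
      Complex.exp (-(∑ j, φ (v j) ^ 2 : ℝ) / 2) := by
  rw [charFunDual_apply, integral_map (Continuous.aemeasurable (by fun_prop))
    (Continuous.aestronglyMeasurable (by fun_prop))]
  have h : ∀ g : Fin n → ℝ, Complex.exp (φ (∑ j, g j • v j) * Complex.I) =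
      ∏ j, Complex.exp (φ (v j) * g j * Complex.I) := by
    intro g
    rw [← Complex.exp_sum]
    congr 1
    simp only [map_sum, map_smul, smul_eq_mul]
    push_cast
    rw [Finset.sum_mul]
    exact Finset.sum_congr rfl fun j _ => by ring
  simp only [h]
  rw [gaussianPi, integral_fintype_prod_eq_prod
    (f := fun j (x : ℝ) => Complex.exp (φ (v j) * x * Complex.I))]
  simp only [← charFun_apply_real, charFun_gaussianReal]
  rw [← Complex.exp_sum]
  congr 1
  push_cast
  rw [neg_div, Finset.sum_div, ← Finset.sum_neg_distrib]
  exact Finset.sum_congr rfl fun j _ => by simp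

lemma gaussianSq_eq_of_finiteDimensional [FiniteDimensional ℝ E] {n m : ℕ} (v : Fin n → E)
    (w : Fin m → E) (h : ∀ φ : E →ₗ[ℝ] ℝ, ∑ j, φ (v j) ^ 2 = ∑ i, φ (w i) ^ 2) :
    gaussianSq v = gaussianSq w := by
  let _ : MeasurableSpace E := borel E
  have : BorelSpace E := ⟨rfl⟩
  have : CompleteSpace E := FiniteDimensional.complete ℝ E
  have : ProperSpace E := FiniteDimensional.proper ℝ E
  have hv : Measurable fun g : Fin n → ℝ => ∑ j, g j • v j :=
    Continuous.measurable (by fun_prop)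
  have hw : Measurable fun g : Fin m → ℝ => ∑ j, g j • w j :=
    Continuous.measurable (by fun_prop)
  have := Measure.isProbabilityMeasure_map (μ := gaussianPi n) hv.aemeasurable
  have := Measure.isProbabilityMeasure_map (μ := gaussianPi m) hw.aemeasurable
  have hμ : (gaussianPi n).map (fun g => ∑ j, g j • v j) =
      (gaussianPi m).map fun g => ∑ j, g j • w j := by
    refine Measure.ext_of_charFunDual (funext fun φ => ?_)
    rw [charFunDual_gaussianPi_map, charFunDual_gaussianPi_map]
    have := h φ.toLinearMap
    simp only [ContinuousLinearMap.coe_coe] at this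
    rw [this]
  have hn : ∀ ν : Measure E, AEStronglyMeasurable (fun x : E => ‖x‖ ^ 2) ν := fun ν =>
    Continuous.aestronglyMeasurable (by fun_prop)
  rw [gaussianSq, gaussianSq, ← integral_map hv.aemeasurable (hn _), hμ,
    integral_map hw.aemeasurable (hn _)]

/-- Kwapień's condition: in the presence of type and cotype 2, the sums of squared norms are
controlled by the underlying quadratic forms on the dual. -/
lemma sum_sq_norm_le_of_forall_dual_eq {C' : ℝ} (hT : HasTypeTwo E C) (hC' : 0 ≤ C')
    (hE : HasCotypeTwo E C') {n m : ℕ} (v : Fin n → E) (w : Fin m → E)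
    (h : ∀ φ : E →ₗ[ℝ] ℝ, ∑ j, φ (v j) ^ 2 = ∑ i, φ (w i) ^ 2) :
    ∑ j, ‖v j‖ ^ 2 ≤ C' * C * ∑ i, ‖w i‖ ^ 2 := by
  set W := Submodule.span ℝ (Set.range v ∪ Set.range w) with hW
  have : FiniteDimensional ℝ W :=
    FiniteDimensional.span_of_finite ℝ ((Set.finite_range v).union (Set.finite_range w))
  let v' : Fin n → W := fun j => ⟨v j, Submodule.subset_span (Or.inl ⟨j, rfl⟩)⟩
  let w' : Fin m → W := fun i => ⟨w i, Submodule.subset_span (Or.inr ⟨i, rfl⟩)⟩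
  have e : gaussianSq v' = gaussianSq w' := by
    refine gaussianSq_eq_of_finiteDimensional v' w' fun φ => ?_
    obtain ⟨ψ, rfl⟩ := φ.exists_extend
    exact h ψ
  have ev : gaussianSq v' = gaussianSq v := by
    simp only [gaussianSq, Submodule.coe_norm, Submodule.coe_sum, Submodule.coe_smul, v']
  have ew : gaussianSq w' = gaussianSq w := by
    simp only [gaussianSq, Submodule.coe_norm, Submodule.coe_sum, Submodule.coe_smul, w']
  calc ∑ j, ‖v j‖ ^ 2 ≤ C' * gaussianSq v := hE.le_gaussianSq v
    _ = C' * gaussianSq w := by rw [← ev, e, ew]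
    _ ≤ C' * (C * ∑ i, ‖w i‖ ^ 2) := by gcongr; exact hT.gaussianSq_le w
    _ = _ := by ring

end Gaussian

section Kwapien

variable {E : Type*} [NormedAddCommGroup E] [NormedSpace ℝ E] {C : ℝ}

/-- The quadratic form on the algebraic dual given by squared evaluation at `x`. -/
def evalSq (x : E) : (E →ₗ[ℝ] ℝ) → ℝ := fun φ => φ x ^ 2

lemma evalSq_smul (c : ℝ) (x : E) : evalSq (c • x) = c ^ 2 • evalSq x := by
  ext φ; simp [evalSq, mul_pow]

/-- The cone of formal inequalities used to separate in Kwapień's theorem. -/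
def kwapienCone (E : Type*) [NormedAddCommGroup E] [NormedSpace ℝ E] (C : ℝ) :
    PointedCone ℝ (((E →ₗ[ℝ] ℝ) → ℝ) × ℝ) :=
  Submodule.span _ (Set.range (fun y : E => (evalSq y, C * ‖y‖ ^ 2)) ∪
    Set.range fun z : E => (-evalSq z, -‖z‖ ^ 2))

lemma exists_of_mem_kwapienCone {P : ((E →ₗ[ℝ] ℝ) → ℝ) × ℝ} (hP : P ∈ kwapienCone E C) :
    ∃ (n m : ℕ) (y : Fin n → E) (z : Fin m → E),
      P = (∑ j, evalSq (y j) - ∑ i, evalSq (z i), C * ∑ j, ‖y j‖ ^ 2 - ∑ i, ‖z i‖ ^ 2) := by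
  induction hP using Submodule.span_induction with
  | mem P h =>
    rcases h with ⟨y, rfl⟩ | ⟨z, rfl⟩
    · exact ⟨1, 0, fun _ => y, Fin.elim0, by simp⟩
    · exact ⟨0, 1, Fin.elim0, fun _ => z, by simp⟩
  | zero => exact ⟨0, 0, Fin.elim0, Fin.elim0, by ext <;> simp⟩
  | add P Q _ _ hP hQ =>
    obtain ⟨n, m, y, z, rfl⟩ := hP
    obtain ⟨n', m', y', z', rfl⟩ := hQ
    refine ⟨n + n', m + m', Fin.append y y', Fin.append z z', ?_⟩
    simp only [Fin.sum_univ_add, Fin.append_left, Fin.append_right, Prod.mk_add_mk]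
    congr 1
    · abel
    · ring
  | smul c P _ hP =>
    obtain ⟨n, m, y, z, rfl⟩ := hP
    refine ⟨n, m, fun j => √(c : ℝ) • y j, fun i => √(c : ℝ) • z i, ?_⟩
    have hc : √(c : ℝ) ^ 2 = c := Real.sq_sqrt c.2
    simp only [evalSq_smul, norm_smul, mul_pow, Real.norm_eq_abs, sq_abs, hc,
      ← Finset.smul_sum, ← Finset.mul_sum, Prod.smul_mk, smul_sub]
    congr 1
    change (c : ℝ) * (C * ∑ j, ‖y j‖ ^ 2) - (c : ℝ) * ∑ i, ‖z i‖ ^ 2 = _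
    ring

/-- The Hahn–Banach step in Kwapień's theorem. -/
lemma exists_linear_of_kwapien
    (h : ∀ (n m : ℕ) (v : Fin n → E) (w : Fin m → E),
      (∀ φ : E →ₗ[ℝ] ℝ, ∑ j, φ (v j) ^ 2 = ∑ i, φ (w i) ^ 2) →
        ∑ j, ‖v j‖ ^ 2 ≤ C * ∑ i, ‖w i‖ ^ 2) :
    ∃ l : Submodule.span ℝ (Set.range (evalSq (E := E))) →ₗ[ℝ] ℝ, ∀ x : E,
      ‖x‖ ^ 2 ≤ l ⟨evalSq x, Submodule.subset_span ⟨x, rfl⟩⟩ ∧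
      l ⟨evalSq x, Submodule.subset_span ⟨x, rfl⟩⟩ ≤ C * ‖x‖ ^ 2 := by
  set V := Submodule.span ℝ (Set.range (evalSq (E := E)))
  let s : PointedCone ℝ (V × ℝ) :=
    (kwapienCone E C).comap ((V.subtype.prodMap LinearMap.id).restrictScalars _)
  have hs : ∀ P : V × ℝ, P ∈ s ↔ ((P.1 : (E →ₗ[ℝ] ℝ) → ℝ), P.2) ∈ kwapienCone E C :=
    fun P => Iff.rfl
  let f : V × ℝ →ₗ.[ℝ] ℝ :=
    ⟨LinearMap.ker (LinearMap.fst ℝ V ℝ), (LinearMap.snd ℝ V ℝ).domRestrict _⟩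
  have hf : ∀ t : ℝ, ((0 : V), t) ∈ f.domain := fun t => by simp [f]
  have hy : ∀ y : E, (evalSq y, C * ‖y‖ ^ 2) ∈ kwapienCone E C := fun y =>
    Submodule.subset_span (Or.inl ⟨y, rfl⟩)
  have hz : ∀ z : E, (-evalSq z, -‖z‖ ^ 2) ∈ kwapienCone E C := fun z =>
    Submodule.subset_span (Or.inr ⟨z, rfl⟩)
  have hdense : ∀ v ∈ V, (∃ t : ℝ, (v, t) ∈ kwapienCone E C) ∧
      ∃ t : ℝ, (-v, t) ∈ kwapienCone E C := by
    intro v hv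
    induction hv using Submodule.span_induction with
    | mem v h => obtain ⟨y, rfl⟩ := h; exact ⟨⟨_, hy y⟩, _, hz y⟩
    | zero => rw [neg_zero]; exact ⟨⟨0, zero_mem _⟩, 0, zero_mem _⟩
    | add u v _ _ hu hv =>
      obtain ⟨⟨t, ht⟩, r, hr⟩ := hu
      obtain ⟨⟨t', ht'⟩, r', hr'⟩ := hv
      exact ⟨⟨t + t', add_mem ht ht'⟩, r + r', by rw [neg_add]; exact add_mem hr hr'⟩
    | smul c v _ hv =>
      obtain ⟨⟨t, ht⟩, r, hr⟩ := hv
      rcases le_total 0 c with hc | hc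
      · refine ⟨⟨_, Submodule.smul_mem _ ⟨c, hc⟩ ht⟩, c * r, ?_⟩
        rw [← smul_neg]
        exact Submodule.smul_mem _ ⟨c, hc⟩ hr
      · have hc' : 0 ≤ -c := neg_nonneg.2 hc
        refine ⟨⟨-c * r, ?_⟩, -c * t, ?_⟩
        · rw [← neg_smul_neg]
          exact Submodule.smul_mem _ ⟨-c, hc'⟩ hr
        · rw [← neg_smul]
          exact Submodule.smul_mem _ ⟨-c, hc'⟩ ht
  have hnonneg : ∀ x : f.domain, (x : V × ℝ) ∈ s → 0 ≤ f x := by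
    rintro ⟨⟨v, t⟩, hv⟩ hx
    obtain rfl : v = 0 := hv
    obtain ⟨n, m, y, z, e⟩ := exists_of_mem_kwapienCone ((hs _).1 hx)
    obtain ⟨e1, e2⟩ := Prod.mk.inj e
    change 0 ≤ t
    change t = _ at e2
    rw [e2, sub_nonneg]
    refine h m n z y fun φ => ?_
    have := congrFun e1 φ
    simp only [Submodule.coe_zero, Pi.zero_apply, Pi.sub_apply, Finset.sum_apply, evalSq] at this
    linarith
  obtain ⟨g, hg, hgs⟩ := riesz_extension s f hnonneg fun ⟨v, r⟩ => by
    obtain ⟨t, ht⟩ := (hdense v v.2).1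
    exact ⟨⟨_, hf (t - r)⟩, (hs _).2 (by simpa using ht)⟩
  have hg0 : ∀ t : ℝ, g (0, t) = t := fun t => hg ⟨_, hf t⟩
  have hgv : ∀ (v : V) (t : ℝ), g (v, t) = g (v, 0) + t := by
    intro v t
    rw [← hg0 t, ← map_add]
    simp [hg0]
  refine ⟨g ∘ₗ LinearMap.inl ℝ V ℝ ∘ₗ (-LinearMap.id), fun x => ?_⟩
  set u : V := ⟨evalSq x, Submodule.subset_span ⟨x, rfl⟩⟩
  have e : (g ∘ₗ LinearMap.inl ℝ V ℝ ∘ₗ (-LinearMap.id)) u = -g (u, 0) := by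
    rw [← map_neg, Prod.neg_mk, neg_zero]; rfl
  rw [e]
  constructor
  · have := hgs (-u, -‖x‖ ^ 2) ((hs _).2 (hz x))
    rw [hgv, show ((-u, 0) : V × ℝ) = -(u, 0) by simp, map_neg] at this
    linarith
  · have := hgs (u, C * ‖x‖ ^ 2) ((hs _).2 (hy x))
    rw [hgv] at this
    linarith

/-- Kwapień's theorem, from the comparison of sums of squared norms. -/
lemma exists_isRealInner_of_kwapien
    (h : ∀ (n m : ℕ) (v : Fin n → E) (w : Fin m → E),
      (∀ φ : E →ₗ[ℝ] ℝ, ∑ j, φ (v j) ^ 2 = ∑ i, φ (w i) ^ 2) →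
        ∑ j, ‖v j‖ ^ 2 ≤ C * ∑ i, ‖w i‖ ^ 2) :
    ∃ B : E → E → ℝ, IsRealInner E B ∧ ∀ x, ‖x‖ ^ 2 ≤ B x x ∧ B x x ≤ C * ‖x‖ ^ 2 := by
  set V := Submodule.span ℝ (Set.range (evalSq (E := E)))
  obtain ⟨l, hl⟩ : ∃ l : V →ₗ[ℝ] ℝ, _ := exists_linear_of_kwapien h
  have hmem : ∀ x y : E, (fun φ : E →ₗ[ℝ] ℝ => φ x * φ y) ∈ V := by
    intro x y
    have e : (fun φ : E →ₗ[ℝ] ℝ => φ x * φ y) =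
        (1 / 4 : ℝ) • (evalSq (x + y) - evalSq (x - y)) := by
      ext φ
      simp [evalSq]
      ring
    rw [e]
    exact V.smul_mem _ (V.sub_mem (Submodule.subset_span ⟨_, rfl⟩) (Submodule.subset_span ⟨_, rfl⟩))
  have hB : ∀ x, ‖x‖ ^ 2 ≤ l ⟨_, hmem x x⟩ ∧ l ⟨_, hmem x x⟩ ≤ C * ‖x‖ ^ 2 := by
    intro x
    have e : (⟨_, hmem x x⟩ : V) = ⟨evalSq x, Submodule.subset_span ⟨x, rfl⟩⟩ :=
      Subtype.ext (funext fun φ => (sq (φ x)).symm)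
    rw [e]
    exact hl x
  refine ⟨fun x y => l ⟨_, hmem x y⟩, ⟨fun x y => ?_, fun a x y => ?_, fun x y z => ?_,
    fun x hx => ?_⟩, hB⟩
  · exact congrArg l (Subtype.ext (funext fun φ => mul_comm _ _))
  · rw [← smul_eq_mul, ← map_smul]
    exact congrArg l (Subtype.ext (funext fun φ => by simp [mul_assoc]))
  · rw [← map_add]
    exact congrArg l (Subtype.ext (funext fun φ => by simp [add_mul]))
  · have := norm_pos_iff.2 hx
    exact lt_of_lt_of_le (by positivity) (hB x).1

end Kwapien

/-- Theorem 3.C.4 (Lipschitz analogue of Kwapień's theorem): if a real Banach space `X`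
bi-Lipschitz embeds into an `L^q`-space and into an `L^p`-space, where
`1 ≤ p ≤ 2 ≤ q < ∞`, then `X` is isomorphic to a Hilbert space. -/
theorem biLipschitz_embeds_in_Lq_and_Lp_implies_hilbert [CompleteSpace X]
    (p q : ℝ≥0∞) [Fact (1 ≤ p)] [Fact (1 ≤ q)] (hp2 : p ≤ 2) (hq2 : 2 ≤ q) (hq : q < ∞)
    (hf : ∃ (Ω₁ : Type v) (m₁ : MeasurableSpace Ω₁) (μ₁ : @Measure Ω₁ m₁)
      (f : X → Lp ℝ q μ₁) (m M : ℝ), 0 < m ∧ m ≤ M ∧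
        ∀ x y : X, m * ‖x - y‖ ≤ ‖f x - f y‖ ∧ ‖f x - f y‖ ≤ M * ‖x - y‖)
    (hg : ∃ (Ω₂ : Type w) (m₂ : MeasurableSpace Ω₂) (μ₂ : @Measure Ω₂ m₂)
      (g : X → Lp ℝ p μ₂) (m M : ℝ), 0 < m ∧ m ≤ M ∧
        ∀ x y : X, m * ‖x - y‖ ≤ ‖g x - g y‖ ∧ ‖g x - g y‖ ≤ M * ‖x - y‖) :
    IsomorphicToHilbert X := by
  obtain ⟨Ω₁, m₁, μ₁, f, c, L, hc, hcL, hf⟩ := hf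
  obtain ⟨Ω₂, m₂, μ₂, g, c', L', hc', hcL', hg⟩ := hg
  obtain ⟨K, hK, hKT⟩ := exists_Lp_hasTypeTwo (μ := μ₁) hq2 hq.ne
  have hL : 0 < L := hc.trans_le hcL
  have hL' : 0 < L' := hc'.trans_le hcL'
  have hT := hKT.of_biLipschitz hK.le hL (fun x y => (hf x y).2) hc fun x y => (hf x y).1
  have hE := (Lp_hasCotypeTwo (μ := μ₂) hp2).of_biLipschitz (by norm_num) hL'
    (fun x y => (hg x y).2) hc' fun x y => (hg x y).1
  obtain ⟨B, hB, hBX⟩ := exists_isRealInner_of_kwapien fun n m v w =>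
    sum_sq_norm_le_of_forall_dual_eq hT (by positivity) hE v w
  exact ⟨B, hB, 1, 4 * 4 * L' ^ 2 / c' ^ 2 * (4 * K * L ^ 2 / c ^ 2), one_pos, by positivity,
    fun x => by simpa using hBX x⟩
end

section
/- Let X be a finite-dimensional real normed space. Then the norm of X arises from an inner product (i.e., there is a real inner product ⟨·,·⟩ on X with ‖x‖² = ⟨x,x⟩ for all x) if and only if for every linear map T : X → X, the set N(T) = {x ∈ X : ‖T(x)‖ = ‖T‖·‖x‖} is a linear subspace of X, where ‖T‖ is the operator norm of T. -/
universe u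

variable (X : Type u) [NormedAddCommGroup X] [NormedSpace ℝ X]

/-- The norm of `X` is induced by an inner product: `‖x‖² = ⟨x, x⟩` for all `x`. -/
def IsometricallyHilbert : Prop :=
  ∃ f : X → X → ℝ, IsRealInner X f ∧ ∀ x : X, ‖x‖ ^ 2 = f x x

open MeasureTheory Filter Topology

section Forward

variable {X}

theorem IsRealInner.parallelogram {f : X → X → ℝ} (hf : IsRealInner X f) (x y : X) :
    f (x + y) (x + y) + f (x - y) (x - y) = 2 * f x x + 2 * f y y := by
  obtain ⟨hs, hm, ha, -⟩ := hf
  have hn : ∀ u v, f (-u) v = - f u v := fun u v => by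
    have := hm (-1) u v
    simpa using this
  have ha' : ∀ u v w, f u (v + w) = f u v + f u w := fun u v w => by
    rw [hs, ha, hs v, hs w]
  have hn' : ∀ u v, f u (-v) = - f u v := fun u v => by rw [hs, hn, hs v]
  simp only [sub_eq_add_neg, ha, ha', hn, hn']
  ring

theorem IsometricallyHilbert.exists_submodule_norming (h : IsometricallyHilbert X)
    (T : X →L[ℝ] X) :
    ∃ S : Submodule ℝ X, (S : Set X) = {x : X | ‖T x‖ = ‖T‖ * ‖x‖} := by
  obtain ⟨f, hf, hfn⟩ := h
  have par : ∀ x y : X, ‖x + y‖ ^ 2 + ‖x - y‖ ^ 2 = 2 * ‖x‖ ^ 2 + 2 * ‖y‖ ^ 2 := fun x y => by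
    simp only [hfn, hf.parallelogram]
  have sq_le : ∀ x, ‖T x‖ ^ 2 ≤ (‖T‖ * ‖x‖) ^ 2 := fun x =>
    pow_le_pow_left₀ (norm_nonneg _) (T.le_opNorm x) 2
  refine ⟨{ carrier := {x : X | ‖T x‖ = ‖T‖ * ‖x‖}, add_mem' := ?_, zero_mem' := ?_,
            smul_mem' := ?_ }, rfl⟩
  · intro x y hx hy
    simp only [Set.mem_ofPred_eq] at hx hy ⊢
    have h1 := par x y
    have h2 := par (T x) (T y)
    rw [← map_add, ← map_sub, hx, hy] at h2
    have h3 := sq_le (x + y)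
    have h4 := sq_le (x - y)
    refine (pow_left_inj₀ (norm_nonneg _) (by positivity) two_ne_zero).1 ?_
    simp only [mul_pow] at *
    nlinarith
  · simp
  · intro c x hx
    simp only [Set.mem_ofPred_eq] at hx ⊢
    rw [map_smul, norm_smul, norm_smul, hx]
    ring

end Forward

section Backward

variable {X}
variable [FiniteDimensional ℝ X]

/-- A functional on operators that does not vanish identically on `{φ ⊗ w : w ∈ X}` for any
`φ ≠ 0` is maximized over the unit ball of operators at an isometry. -/
theorem exists_isometry_isMax [Nontrivial X]
    (H : ∀ T : X →L[ℝ] X, ∃ S : Submodule ℝ X, (S : Set X) = {x : X | ‖T x‖ = ‖T‖ * ‖x‖})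
    (l : (X →L[ℝ] X) →ₗ[ℝ] ℝ)
    (hl : ∀ φ : X →L[ℝ] ℝ, φ ≠ 0 → ∃ w, l (φ.smulRight w) ≠ 0) :
    ∃ T : X ≃ₗᵢ[ℝ] X, ∀ S : X →L[ℝ] X, ‖S‖ ≤ 1 →
      l S ≤ l (T.toContinuousLinearEquiv : X →L[ℝ] X) := by
  have : ProperSpace X := FiniteDimensional.proper ℝ X
  have : ProperSpace (X →L[ℝ] X) := FiniteDimensional.proper ℝ _
  have lcont : Continuous l := l.continuous_of_finiteDimensional
  obtain ⟨T, hT, hmax⟩ := (isCompact_closedBall (0 : X →L[ℝ] X) 1).exists_isMaxOn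
    ⟨0, by simp⟩ lcont.continuousOn
  have hT1 : ‖T‖ ≤ 1 := by simpa using hT
  have hmax' : ∀ S : X →L[ℝ] X, ‖S‖ ≤ 1 → l S ≤ l T := fun S hS => hmax (by simpa using hS)
  have hle : ∀ S : X →L[ℝ] X, l S ≤ l T * ‖S‖ := fun S => by
    rcases eq_or_ne S 0 with rfl | hS
    · simp
    have hpos : 0 < ‖S‖ := norm_pos_iff.2 hS
    have h1 := hmax' (‖S‖⁻¹ • S) (by rw [norm_smul, norm_inv, norm_norm, inv_mul_cancel₀ hpos.ne'])
    rw [map_smul, smul_eq_mul, inv_mul_le_iff₀ hpos] at h1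
    linarith
  suffices hiso : ∀ x, ‖T x‖ = ‖x‖ by
    let L : X →ₗᵢ[ℝ] X := ⟨T, hiso⟩
    refine ⟨L.toLinearIsometryEquiv rfl, fun S hS => ?_⟩
    exact hmax' S hS
  obtain ⟨V, hV⟩ := H T
  have memV : ∀ x, x ∈ V ↔ ‖T x‖ = ‖T‖ * ‖x‖ := fun x => by
    rw [← SetLike.mem_coe, hV]; rfl
  have key : ∀ R : X →L[ℝ] X, (∀ x ∈ V, R x = 0) → l R ≤ 0 := by
    intro R hR
    by_contra! hpos
    have hM : 0 < l T := by
      by_contra! hM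
      have := hle R
      nlinarith [norm_nonneg R]
    have ex : ∀ n : ℕ, ∃ x : X, ‖x‖ = 1 ∧ l R / l T ≤ ‖R x‖ ∧
        1 - (1 / ((n : ℝ) + 1)) * ‖R‖ ≤ ‖T x‖ := by
      intro n
      set ε : ℝ := 1 / ((n : ℝ) + 1)
      have hε : 0 < ε := by positivity
      obtain ⟨x, hx, hxmax⟩ := (isCompact_sphere (0 : X) 1).exists_isMaxOn
        (NormedSpace.sphere_nonempty.2 zero_le_one) (f := fun x => ‖(T + ε • R) x‖)
        (by fun_prop)
      have hx1 : ‖x‖ = 1 := by simpa using hx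
      have hop : ‖T + ε • R‖ ≤ ‖(T + ε • R) x‖ := by
        refine ContinuousLinearMap.opNorm_le_of_unit_norm (norm_nonneg _) fun z hz => ?_
        exact hxmax (by simpa using hz)
      have h1 := hle (T + ε • R)
      have h2 : ‖(T + ε • R) x‖ ≤ ‖T x‖ + ε * ‖R x‖ := by
        simpa [norm_smul, abs_of_pos hε] using norm_add_le (T x) (ε • R x)
      have h3 : ‖T x‖ ≤ 1 := by
        have := T.le_opNorm x
        rw [hx1] at this; linarith
      have h4 : ‖R x‖ ≤ ‖R‖ := by
        have := R.le_opNorm x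
        rwa [hx1, mul_one] at this
      have h5 : l T + ε * l R ≤ l T * (‖T x‖ + ε * ‖R x‖) := by
        rw [map_add, map_smul, smul_eq_mul] at h1
        exact h1.trans (mul_le_mul_of_nonneg_left (hop.trans h2) hM.le)
      refine ⟨x, hx1, ?_, ?_⟩
      · rw [div_le_iff₀ hM]
        have h6 : l T * ‖T x‖ ≤ l T := by nlinarith
        have h7 : ε * l R ≤ ε * (‖R x‖ * l T) := by nlinarith
        exact le_of_mul_le_mul_left h7 hε
      · have h6 : l T * 1 ≤ l T * (‖T x‖ + ε * ‖R x‖) := by nlinarith [mul_pos hε hpos]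
        have h7 := le_of_mul_le_mul_left h6 hM
        have h8 : ε * ‖R x‖ ≤ ε * ‖R‖ := mul_le_mul_of_nonneg_left h4 hε.le
        linarith
    choose u hu1 huR huT using ex
    obtain ⟨x, hx, φ, hφ, hlim⟩ := (isCompact_sphere (0 : X) 1).tendsto_subseq
      (x := u) (fun n => by simpa using hu1 n)
    have hx1 : ‖x‖ = 1 := by simpa using hx
    have hRx : l R / l T ≤ ‖R x‖ :=
      ge_of_tendsto' ((R.continuous.norm.tendsto x).comp hlim) fun n => huR (φ n)
    have hTx : 1 - 0 * ‖R‖ ≤ ‖T x‖ := by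
      refine le_of_tendsto_of_tendsto' (Tendsto.const_sub 1 (Tendsto.mul_const ‖R‖ ?_))
        ((T.continuous.norm.tendsto x).comp hlim) fun n => huT (φ n)
      exact tendsto_one_div_add_atTop_nhds_zero_nat.comp hφ.tendsto_atTop
    have hxV : x ∈ V := by
      rw [memV]
      have := T.le_opNorm x
      rw [hx1] at this ⊢
      linarith
    rw [hR x hxV, norm_zero] at hRx
    exact absurd (div_pos hpos hM) (not_lt.2 hRx)
  have hVtop : V = ⊤ := by
    by_contra hne
    obtain ⟨φ, hφ0, hφV⟩ := Submodule.exists_le_ker_of_lt_top V (lt_top_iff_ne_top.2 hne)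
    let ψ : X →L[ℝ] ℝ := LinearMap.toContinuousLinearMap φ
    have hψ : ψ ≠ 0 := fun h => hφ0 (LinearMap.ext fun x => congrArg (fun g : X →L[ℝ] ℝ => g x) h)
    have hψV : ∀ x ∈ V, ψ x = 0 := fun x hx => hφV hx
    obtain ⟨w, hw⟩ := hl ψ hψ
    have h1 := key (ψ.smulRight w) fun x hx => by simp [hψV x hx]
    have h2 := key (-ψ.smulRight w) fun x hx => by simp [hψV x hx]
    rw [map_neg] at h2
    exact hw (by linarith)
  have hnorm : ‖T‖ = 1 := by
    refine le_antisymm hT1 ?_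
    obtain ⟨x, hx⟩ := exists_ne (0 : X)
    obtain ⟨φ, -, hφx⟩ := exists_dual_vector ℝ x (norm_ne_zero_iff.2 hx)
    have hφ0 : φ ≠ 0 := by
      rintro rfl
      simp [eq_comm, hx] at hφx
    obtain ⟨w, hw⟩ := hl φ hφ0
    have hM : 0 < l T := by
      by_contra! hM
      have h1 := hle (φ.smulRight w)
      have h2 := hle (-φ.smulRight w)
      rw [map_neg, norm_neg] at h2
      have h3 := mul_nonpos_of_nonpos_of_nonneg hM (norm_nonneg (φ.smulRight w))
      exact hw (by linarith)
    have := hle T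
    exact (le_mul_iff_one_le_right hM).1 this
  intro x
  have := (memV x).1 (hVtop ▸ Submodule.mem_top)
  rwa [hnorm, one_mul] at this

variable (X)

/-- Every finite-dimensional normed space carries an inner product that is invariant under all
linear isometries. -/
theorem exists_isometry_invariant_inner :
    ∃ B : X →ₗ[ℝ] Module.Dual ℝ X, (∀ x y, B x y = B y x) ∧ (∀ x, x ≠ 0 → 0 < B x x) ∧
      ∀ (T : X ≃ₗᵢ[ℝ] X) (x : X), B (T x) (T x) = B x x := by
  have : ProperSpace X := FiniteDimensional.proper ℝ X
  let _ : MeasurableSpace X := borel X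
  have : BorelSpace X := ⟨rfl⟩
  let μ : Measure X := Measure.hausdorffMeasure (Module.finrank ℝ X)
  have : μ.IsAddHaarMeasure := inferInstance
  have hcont : ∀ f : Module.Dual ℝ X, Continuous f := fun f => f.continuous_of_finiteDimensional
  have hint : ∀ f : Module.Dual ℝ X,
      IntegrableOn (fun x => f x • x) (Metric.closedBall (0 : X) 1) μ := fun f =>
    ((hcont f).smul continuous_id).continuousOn.integrableOn_compact (isCompact_closedBall _ _)
  let J : Module.Dual ℝ X →ₗ[ℝ] X :=
    { toFun := fun f => ∫ x in Metric.closedBall (0 : X) 1, f x • x ∂μ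
      map_add' := fun f g => by
        rw [← integral_add (hint f) (hint g)]
        simp only [LinearMap.add_apply, add_smul]
      map_smul' := fun c f => by
        simp only [LinearMap.smul_apply, smul_assoc, RingHom.id_apply]
        rw [integral_smul] }
  have hJ : ∀ f g : Module.Dual ℝ X,
      g (J f) = ∫ x in Metric.closedBall (0 : X) 1, f x * g x ∂μ := fun f g => by
    have := (LinearMap.toContinuousLinearMap g).integral_comp_comm (hint f)
    simp only [LinearMap.coe_toContinuousLinearMap', map_smul, smul_eq_mul] at this
    exact this.symm
  have hpos : ∀ f : Module.Dual ℝ X, f ≠ 0 → 0 < f (J f) := by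
    intro f hf
    rw [hJ, setIntegral_pos_iff_support_of_nonneg_ae
      (Eventually.of_forall fun x => mul_self_nonneg (f x))
      (((hcont f).mul (hcont f)).continuousOn.integrableOn_compact (isCompact_closedBall _ _))]
    obtain ⟨x, hx⟩ : ∃ x, f x ≠ 0 := by
      by_contra! h
      exact hf (LinearMap.ext h)
    have hx0 : x ≠ 0 := by rintro rfl; simp at hx
    have hopen : IsOpen ({x | f x ≠ 0} ∩ Metric.ball (0 : X) 1) :=
      (isOpen_ne_fun (hcont f) continuous_const).inter Metric.isOpen_ball
    refine (hopen.measure_pos μ ⟨(2 * ‖x‖)⁻¹ • x, ?_, ?_⟩).trans_le (measure_mono ?_)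
    · simp [hx, hx0]
    · have : ‖x‖ ≠ 0 := norm_ne_zero_iff.2 hx0
      rw [mem_ball_zero_iff, norm_smul, norm_inv, norm_mul, norm_norm]
      field_simp
      norm_num
    · rintro z ⟨hz, hz'⟩
      exact ⟨by simpa using hz, Metric.ball_subset_closedBall hz'⟩
  have hinj : Function.Injective J := by
    rw [injective_iff_map_eq_zero]
    intro f hf
    by_contra h
    have := hpos f h
    simp [hf] at this
  let e : Module.Dual ℝ X ≃ₗ[ℝ] X := J.linearEquivOfInjective hinj Subspace.dual_finrank_eq
  have he : ∀ f, e f = J f := fun f => LinearMap.linearEquivOfInjective_apply ..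
  have hT : ∀ (T : X ≃ₗᵢ[ℝ] X) (f : Module.Dual ℝ X),
      T (J (f ∘ₗ T.toLinearEquiv.toLinearMap)) = J f := by
    intro T f
    have h1 := T.toContinuousLinearEquiv.toContinuousLinearMap.integral_comp_comm
      (hint (f ∘ₗ T.toLinearEquiv.toLinearMap))
    have h2 := (T.toIsometryEquiv.measurePreserving_hausdorffMeasure
      (Module.finrank ℝ X)).setIntegral_preimage_emb
      T.toIsometryEquiv.toHomeomorph.measurableEmbedding (fun x => f x • x)
      (Metric.closedBall (0 : X) 1)
    have h3 : T.toIsometryEquiv ⁻¹' Metric.closedBall (0 : X) 1 = Metric.closedBall 0 1 := by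
      ext z
      simp
    rw [h3] at h2
    simpa [J, μ] using h1.symm.trans (by simpa [J, μ] using h2)
  refine ⟨e.symm.toLinearMap, fun x y => ?_, fun x hx => ?_, fun T x => ?_⟩
  · obtain ⟨f, rfl⟩ := e.surjective x
    obtain ⟨g, rfl⟩ := e.surjective y
    simp only [LinearEquiv.coe_coe, LinearEquiv.symm_apply_apply]
    simp only [he, hJ, mul_comm]
  · obtain ⟨f, rfl⟩ := e.surjective x
    rw [LinearEquiv.coe_coe, LinearEquiv.symm_apply_apply, he]
    exact hpos f (by rintro rfl; simp at hx)
  · obtain ⟨f, hf⟩ := e.surjective (T x)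
    have hx : x = e (f ∘ₗ T.toLinearEquiv.toLinearMap) := T.injective (by rw [he, hT, ← he, hf])
    have hx' : e.symm x = f ∘ₗ T.toLinearEquiv.toLinearMap := by rw [hx, e.symm_apply_apply]
    simp only [LinearEquiv.coe_coe, hx', ← hf, LinearEquiv.symm_apply_apply]
    rw [hf]
    rfl

variable {X}

/-- The quadratic forms of isometry-invariant inner products are constant on the unit sphere. -/
theorem invariant_inner_le [Nontrivial X]
    (H : ∀ T : X →L[ℝ] X, ∃ S : Submodule ℝ X, (S : Set X) = {x : X | ‖T x‖ = ‖T‖ * ‖x‖})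
    {B : X →ₗ[ℝ] Module.Dual ℝ X} (hs : ∀ x y, B x y = B y x) (hp : ∀ x, x ≠ 0 → 0 < B x x)
    (hB : ∀ (T : X ≃ₗᵢ[ℝ] X) (x : X), B (T x) (T x) = B x x)
    {x y : X} (hx : ‖x‖ = 1) (hy : ‖y‖ = 1) : B y y ≤ B x x := by
  wlog hxy : 0 ≤ B y x generalizing x with h
  · have := h (x := -x) (by simpa using hx) (by simp; linarith)
    simpa using this
  have hy0 : y ≠ 0 := by rintro rfl; simp at hy
  have hx0 : x ≠ 0 := by rintro rfl; simp at hx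
  have hnn : ∀ z, 0 ≤ B z z := fun z => by
    rcases eq_or_ne z 0 with rfl | hz
    · simp
    · exact (hp z hz).le
  have hcs : ∀ z w, B z w ^ 2 ≤ B z z * B w w := fun z w => by
    rcases eq_or_ne z 0 with rfl | hz
    · simp
    have h1 := hnn (B z z • w - B z w • z)
    simp only [map_sub, map_smul, LinearMap.sub_apply, LinearMap.smul_apply, smul_eq_mul,
      hs w z] at h1
    have h2 : 0 ≤ B z z * (B z z * B w w - B z w ^ 2) := by nlinarith
    linarith [nonneg_of_mul_nonneg_right h2 (hp z hz)]
  let tr : (X →L[ℝ] X) →ₗ[ℝ] ℝ := LinearMap.trace ℝ X ∘ₗ ContinuousLinearMap.coeLM ℝ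
  have htr : ∀ (φ : X →L[ℝ] ℝ) (w : X), tr (φ.smulRight w) = φ w := fun φ w =>
    LinearMap.trace_smulRight (φ : X →ₗ[ℝ] ℝ) w
  let C := ‖LinearMap.toContinuousLinearMap tr‖
  have hC : ∀ S : X →L[ℝ] X, ‖S‖ ≤ 1 → |tr S| ≤ C := fun S hS =>
    (LinearMap.toContinuousLinearMap tr).unit_le_opNorm S hS
  obtain ⟨ψ, hψ, hψx⟩ := exists_dual_vector ℝ x (norm_ne_zero_iff.2 hx0)
  have main : ∀ ε : ℝ, 0 < ε → ∃ z, B z z = B x x ∧ B y y - ε * (2 * C) ≤ B y z := by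
    intro ε hε
    let l : (X →L[ℝ] X) →ₗ[ℝ] ℝ :=
      B y ∘ₗ (ContinuousLinearMap.apply ℝ X x).toLinearMap + ε • tr
    have hlS : ∀ S, l S = B y (S x) + ε * tr S := fun S => rfl
    obtain ⟨T, hT⟩ := exists_isometry_isMax H l (by
      intro φ hφ
      by_contra! h
      have h1 : ∀ w, φ x * B y w + ε * φ w = 0 := fun w => by
        have := h w
        rwa [hlS, htr, ContinuousLinearMap.smulRight_apply, map_smul, smul_eq_mul] at this
      have h2 : φ x = 0 := by
        have h3 : φ x * (B y x + ε) = 0 := by linarith [h1 x]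
        exact (mul_eq_zero.1 h3).resolve_right (by positivity)
      refine hφ (ContinuousLinearMap.ext fun w => ?_)
      have h4 := h1 w
      rw [h2, zero_mul, zero_add] at h4
      exact (mul_eq_zero.1 h4).resolve_left hε.ne')
    have hψy : ‖ψ.smulRight y‖ ≤ 1 := by
      rw [ContinuousLinearMap.norm_smulRight_apply, hψ, hy, one_mul]
    have h1 := hT _ hψy
    have hT1 : ‖(T.toContinuousLinearEquiv : X →L[ℝ] X)‖ ≤ 1 :=
      ContinuousLinearMap.opNorm_le_bound _ zero_le_one fun z => by simp
    have h2 := (abs_le.1 (hC _ hT1)).2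
    have h3 := (abs_le.1 (hC _ hψy)).1
    refine ⟨T x, hB T x, ?_⟩
    rw [hlS, hlS] at h1
    have h4 : (ψ.smulRight y) x = y := by
      simp [hψx, hx]
    rw [h4] at h1
    have h5 : B y ((T.toContinuousLinearEquiv : X →L[ℝ] X) x) = B y (T x) := rfl
    rw [h5] at h1
    nlinarith
  have hlim : Tendsto (fun ε : ℝ => B y y - ε * (2 * C)) (𝓝[>] 0) (𝓝 (B y y - 0 * (2 * C))) :=
    (Continuous.tendsto (by fun_prop) 0).mono_left nhdsWithin_le_nhds
  rw [zero_mul, sub_zero] at hlim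
  have hle : B y y ≤ √(B y y * B x x) := by
    refine le_of_tendsto hlim ?_
    filter_upwards [self_mem_nhdsWithin] with ε hε
    obtain ⟨z, hz, hyz⟩ := main ε hε
    exact hyz.trans (Real.le_sqrt_of_sq_le (hz ▸ hcs y z))
  rw [Real.le_sqrt (hnn y) (mul_nonneg (hnn y) (hnn x)), sq] at hle
  exact le_of_mul_le_mul_left hle (hp y hy0)

theorem isometricallyHilbert_of_norming
    (H : ∀ T : X →L[ℝ] X, ∃ S : Submodule ℝ X, (S : Set X) = {x : X | ‖T x‖ = ‖T‖ * ‖x‖}) :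
    IsometricallyHilbert X := by
  obtain ⟨B, hs, hp, hB⟩ := exists_isometry_invariant_inner X
  rcases subsingleton_or_nontrivial X with h | h
  · exact ⟨fun x y => B x y, ⟨hs, by simp, by simp, hp⟩,
      fun x => by simp [Subsingleton.elim x 0]⟩
  obtain ⟨y, hy⟩ := NormedSpace.sphere_nonempty (E := X) (x := 0) |>.2 zero_le_one
  rw [mem_sphere_zero_iff_norm] at hy
  have hc : 0 < B y y := hp y (by rintro rfl; simp at hy)
  refine ⟨fun x z => (B y y)⁻¹ * B x z, ⟨fun x z => by simp only [hs x z], fun a x z => ?_,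
    fun x z w => ?_, fun x hx => mul_pos (inv_pos.2 hc) (hp x hx)⟩, fun x => ?_⟩
  · simp only [map_smul, LinearMap.smul_apply, smul_eq_mul]
    ring
  · simp only [map_add, LinearMap.add_apply]
    ring
  rcases eq_or_ne x 0 with rfl | hx
  · simp
  have hn : ‖x‖ ≠ 0 := norm_ne_zero_iff.2 hx
  have hu : ‖‖x‖⁻¹ • x‖ = 1 := by rw [norm_smul, norm_inv, norm_norm, inv_mul_cancel₀ hn]
  have heq := le_antisymm (invariant_inner_le H hs hp hB hu hy)
    (invariant_inner_le H hs hp hB hy hu)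
  simp only [map_smul, LinearMap.smul_apply, smul_eq_mul] at heq
  field_simp at heq ⊢
  linarith

end Backward

/-- Theorem 3.D.1: the norm of a finite-dimensional real normed space `X` arises from an
inner product iff for every linear map `T : X → X` the set
`N(T) = {x : ‖T x‖ = ‖T‖·‖x‖}` of norming vectors of `T` is a linear subspace of `X`. -/
theorem norm_from_inner_iff_norming_vectors_subspace [FiniteDimensional ℝ X] :
    IsometricallyHilbert X ↔
      ∀ T : X →ₗ[ℝ] X, ∃ S : Submodule ℝ X,
        (S : Set X) = {x : X | ‖T x‖ = ‖LinearMap.toContinuousLinearMap T‖ * ‖x‖} := by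
  refine ⟨fun h T => h.exists_submodule_norming (LinearMap.toContinuousLinearMap T), fun H =>
    isometricallyHilbert_of_norming fun T => ?_⟩
  obtain ⟨S, hS⟩ := H T.toLinearMap
  exact ⟨S, hS⟩
end
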